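/- arXiv:2507.10790 — 2 statements merged into one kernel-verified Lean document; each statement's English description precedes it below -/
import Mathlib

section
/- Let q ≥ 3 be a prime power and let π₁, π₂ be irreducible complex representations of GL₂(q), each of dimension q. Then the tensor product π₁ ⊗ π₂ is multiplicity free, and it contains exactly one isomorphism class of one-dimensional subrepresentations, which occurs with multiplicity one. -/
open CategoryTheory Module MonoidalCategory

noncomputable section

open scoped OnePoint

namespace GLTwo

variable {F : Type} [Field F]

/-- The invertible matrix with rows `(a, b)` and `(c, d)`. -/
def mk (a b c d : F) (h : a * d - b * c ≠ 0) : Matrix.GeneralLinearGroup (Fin 2) F :=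
  Matrix.GeneralLinearGroup.mkOfDetNeZero !![a, b; c, d] (by rwa [Matrix.det_fin_two_of])

lemma coe_mk (a b c d : F) (h : a * d - b * c ≠ 0) :
    (mk a b c d h : Matrix (Fin 2) (Fin 2) F) = !![a, b; c, d] := rfl

lemma mk_mul_mk (a b c d a' b' c' d' : F) (h : a * d - b * c ≠ 0) (h' : a' * d' - b' * c' ≠ 0) :
    mk a b c d h * mk a' b' c' d' h' =
      mk (a * a' + b * c') (a * b' + b * d') (c * a' + d * c') (c * b' + d * d')
        (by convert mul_ne_zero h h' using 1; ring) := by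
  apply Units.ext
  simp [coe_mk]

lemma mk_congr {a b c d a' b' c' d' : F} (h : a * d - b * c ≠ 0) (ha : a = a') (hb : b = b')
    (hc : c = c') (hd : d = d') : mk a b c d h = mk a' b' c' d' (by subst_vars; exact h) := by
  subst_vars; rfl

lemma eq_mk (g : Matrix.GeneralLinearGroup (Fin 2) F) :
    g = mk (g 0 0) (g 0 1) (g 1 0) (g 1 1)
      (by rw [← Matrix.det_fin_two]; exact g.det_ne_zero) := by
  apply Units.ext
  rw [coe_mk]
  exact Matrix.eta_fin_two _

section Action

variable [DecidableEq F]

lemma mk_smul_infty (a b c d : F) (h : a * d - b * c ≠ 0) :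
    mk a b c d h • (∞ : OnePoint F) = if c = 0 then ∞ else ((a / c : F) : OnePoint F) := by
  rw [OnePoint.smul_infty_eq_ite]; rfl

lemma mk_smul_coe (a b c d x : F) (h : a * d - b * c ≠ 0) :
    mk a b c d h • (x : OnePoint F) =
      if c * x + d = 0 then ∞ else (((a * x + b) / (c * x + d) : F) : OnePoint F) := by
  rw [OnePoint.smul_some_eq_ite]; rfl

lemma exists_smul_infty (x : OnePoint F) :
    ∃ g : Matrix.GeneralLinearGroup (Fin 2) F, g • (∞ : OnePoint F) = x := by
  induction x using OnePoint.rec with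
  | infty => exact ⟨1, one_smul _ _⟩
  | coe x => exact ⟨mk x 1 1 0 (by simp), by simp [mk_smul_infty]⟩

lemma exists_smul_infty_zero {x y : OnePoint F} (hxy : x ≠ y) :
    ∃ g : Matrix.GeneralLinearGroup (Fin 2) F,
      g • (∞ : OnePoint F) = x ∧ g • ((0 : F) : OnePoint F) = y := by
  obtain ⟨g, rfl⟩ := exists_smul_infty x
  obtain ⟨z, rfl⟩ : ∃ z, y = g • z := ⟨g⁻¹ • y, by simp⟩
  induction z using OnePoint.rec with
  | infty => exact absurd rfl hxy
  | coe z =>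
    exact ⟨g * mk 1 z 0 1 (by simp), by simp [mul_smul, mk_smul_infty],
      by simp [mul_smul, mk_smul_coe]⟩

lemma exists_smul_infty_zero_one {x y z : OnePoint F} (hxy : x ≠ y) (hxz : x ≠ z) (hyz : y ≠ z) :
    ∃ g : Matrix.GeneralLinearGroup (Fin 2) F, g • (∞ : OnePoint F) = x ∧
      g • ((0 : F) : OnePoint F) = y ∧ g • ((1 : F) : OnePoint F) = z := by
  obtain ⟨g, rfl, rfl⟩ := exists_smul_infty_zero hxy
  obtain ⟨w, rfl⟩ : ∃ w, z = g • w := ⟨g⁻¹ • z, by simp⟩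
  induction w using OnePoint.rec with
  | infty => exact absurd rfl hxz
  | coe w =>
    have hw : w ≠ 0 := by rintro rfl; exact hyz rfl
    exact ⟨g * mk w 0 0 1 (by simpa), by simp [mul_smul, mk_smul_infty],
      by simp [mul_smul, mk_smul_coe], by simp [mul_smul, mk_smul_coe]⟩

/-- Swapping two pairs of points preserves the cross-ratio. -/
lemma exists_smul_swap {a b c d : OnePoint F} (hab : a ≠ b) (hac : a ≠ c) (hbc : b ≠ c)
    (hda : d ≠ a) (hdb : d ≠ b) (hdc : d ≠ c) :
    ∃ g : Matrix.GeneralLinearGroup (Fin 2) F, g • a = c ∧ g • b = d ∧ g • c = a ∧ g • d = b := by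
  obtain ⟨g, rfl, rfl, rfl⟩ := exists_smul_infty_zero_one hab hac hbc
  obtain ⟨w, rfl⟩ : ∃ w, d = g • w := ⟨g⁻¹ • d, by simp⟩
  induction w using OnePoint.rec with
  | infty => exact absurd rfl hda
  | coe w =>
    have h1 : w ≠ 1 := by rintro rfl; exact hdc rfl
    have h1' : w - 1 ≠ 0 := sub_ne_zero.2 h1
    refine ⟨g * mk 1 (-w) 1 (-1) (fun h => h1' (by linear_combination h)) * g⁻¹, ?_, ?_, ?_, ?_⟩ <;>
      simp [mul_smul, mk_smul_infty, mk_smul_coe, ← sub_eq_add_neg, h1']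

end Action

section Kernel

lemma add_card_mul_eq_zero {X : Type*} [Fintype X] {n : ℕ} (hX : Fintype.card X = n + 1)
    {φ : X → ℂ} (hφ : ∑ x, φ x = 0) {a d : X} (h : ∀ x, x ≠ a → φ x = φ d) :
    φ a + (n : ℂ) * φ d = 0 := by
  classical
  rw [← hφ, ← Finset.add_sum_erase _ _ (Finset.mem_univ a),
    Finset.sum_congr rfl fun x hx => h x (Finset.ne_of_mem_erase hx), Finset.sum_const,
    Finset.card_erase_of_mem (Finset.mem_univ a), Finset.card_univ, nsmul_eq_mul, hX]
  simp

lemma add_add_card_sub_one_mul_eq_zero {X : Type*} [Fintype X] {n : ℕ} (hn : 1 ≤ n)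
    (hX : Fintype.card X = n + 1) {φ : X → ℂ} (hφ : ∑ x, φ x = 0) {a c d : X} (hac : a ≠ c)
    (h : ∀ x, x ≠ a → x ≠ c → φ x = φ d) : φ a + φ c + ((n : ℂ) - 1) * φ d = 0 := by
  classical
  have hc : c ∈ Finset.univ.erase a := by simp [hac.symm]
  rw [← hφ, ← Finset.add_sum_erase _ _ (Finset.mem_univ a), ← Finset.add_sum_erase _ _ hc,
    Finset.sum_congr rfl fun x hx =>
      h x (Finset.ne_of_mem_erase (Finset.mem_of_mem_erase hx)) (Finset.ne_of_mem_erase hx),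
    Finset.sum_const, Finset.card_erase_of_mem hc, Finset.card_erase_of_mem (Finset.mem_univ a),
    Finset.card_univ, nsmul_eq_mul, add_assoc, hX]
  simp [hn]

lemma card_onePoint (F : Type) [Fintype F] :
    Fintype.card (OnePoint F) = Fintype.card F + 1 :=
  Fintype.card_option

variable [DecidableEq F] [Fintype F]

/-- A `GL₂`-invariant function on quadruples of points of the projective line which sums to zero in
every variable is invariant under exchanging the first two variables with the last two. -/
theorem kernel_symm (hq : 3 ≤ Fintype.card F)
    (K : OnePoint F → OnePoint F → OnePoint F → OnePoint F → ℂ)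
    (hK : ∀ (g : Matrix.GeneralLinearGroup (Fin 2) F) a b c d,
      K (g • a) (g • b) (g • c) (g • d) = K a b c d)
    (h₁ : ∀ b c d, ∑ x, K x b c d = 0) (h₂ : ∀ a c d, ∑ x, K a x c d = 0)
    (h₃ : ∀ a b d, ∑ x, K a b x d = 0) (h₄ : ∀ a b c, ∑ x, K a b c x = 0)
    (a b c d : OnePoint F) : K a b c d = K c d a b := by
  have hq0 : (Fintype.card F : ℂ) ≠ 0 := by
    exact_mod_cast (by omega : Fintype.card F ≠ 0)
  have hq1 : (Fintype.card F : ℂ) - 1 ≠ 0 := by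
    rw [sub_ne_zero]; exact_mod_cast (by omega : Fintype.card F ≠ 1)
  have e1 : ∀ a a', K a a a a = K a' a' a' a' := by
    have : ∀ a, K ∞ ∞ ∞ ∞ = K a a a a := fun a => by
      obtain ⟨g, rfl⟩ := exists_smul_infty a
      rw [hK]
    exact fun a a' => (this a).symm.trans (this a')
  have e2 : ∀ φ : OnePoint F → OnePoint F → ℂ,
      (∀ (g : Matrix.GeneralLinearGroup (Fin 2) F) a b, φ (g • a) (g • b) = φ a b) →
      ∀ {a b a' b'}, a ≠ b → a' ≠ b' → φ a b = φ a' b' := by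
    intro φ hφ a b a' b' h h'
    obtain ⟨g, rfl, rfl⟩ := exists_smul_infty_zero h
    obtain ⟨g', rfl, rfl⟩ := exists_smul_infty_zero h'
    rw [hφ, hφ]
  have e3 : ∀ φ : OnePoint F → OnePoint F → OnePoint F → ℂ,
      (∀ (g : Matrix.GeneralLinearGroup (Fin 2) F) a b c,
        φ (g • a) (g • b) (g • c) = φ a b c) →
      ∀ {a b c a' b' c'}, a ≠ b → a ≠ c → b ≠ c → a' ≠ b' → a' ≠ c' → b' ≠ c' →
        φ a b c = φ a' b' c' := by
    intro φ hφ a b c a' b' c' h1 h2 h3 h1' h2' h3'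
    obtain ⟨g, rfl, rfl, rfl⟩ := exists_smul_infty_zero_one h1 h2 h3
    obtain ⟨g', rfl, rfl, rfl⟩ := exists_smul_infty_zero_one h1' h2' h3'
    rw [hφ, hφ]
  have t4 : ∀ {a d}, d ≠ a → K a a a a + (Fintype.card F : ℂ) * K a a a d = 0 := fun {a d} h =>
    add_card_mul_eq_zero (card_onePoint F) (h₄ a a a) fun x hx =>
      e2 (fun a d => K a a a d) (fun g a b => hK ..) hx.symm h.symm
  have t3 : ∀ {a d}, d ≠ a → K a a a a + (Fintype.card F : ℂ) * K a a d a = 0 := fun {a d} h =>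
    add_card_mul_eq_zero (card_onePoint F) (h₃ a a a) fun x hx =>
      e2 (fun a d => K a a d a) (fun g a b => hK ..) hx.symm h.symm
  have t2 : ∀ {a d}, d ≠ a → K a a a a + (Fintype.card F : ℂ) * K a d a a = 0 := fun {a d} h =>
    add_card_mul_eq_zero (card_onePoint F) (φ := fun x => K a x a a) (h₂ a a a) fun x hx =>
      e2 (fun a d => K a d a a) (fun g a b => hK ..) hx.symm h.symm
  have t1 : ∀ {a d}, d ≠ a → K a a a a + (Fintype.card F : ℂ) * K d a a a = 0 := fun {a d} h =>
    add_card_mul_eq_zero (card_onePoint F) (φ := fun x => K x a a a) (h₁ a a a) fun x hx =>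
      e2 (fun a d => K d a a a) (fun g a b => hK ..) hx.symm h.symm
  have p12 : ∀ {a c d}, a ≠ c → d ≠ a → d ≠ c →
      K a a c a + K a a c c + ((Fintype.card F : ℂ) - 1) * K a a c d = 0 := fun {a c d} h ha hc =>
    add_add_card_sub_one_mul_eq_zero (by omega) (card_onePoint F)
      (φ := fun x => K a a c x) (h₄ a a c) h fun x hxa hxc =>
      e3 (fun a c x => K a a c x) (fun g a b c => hK ..) h hxa.symm hxc.symm h ha.symm hc.symm
  have p34 : ∀ {a c d}, a ≠ c → d ≠ a → d ≠ c →
      K c a a a + K c c a a + ((Fintype.card F : ℂ) - 1) * K c d a a = 0 := fun {a c d} h ha hc =>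
    add_add_card_sub_one_mul_eq_zero (by omega) (card_onePoint F)
      (φ := fun x => K c x a a) (h₂ c a a) h fun x hxa hxc =>
      e3 (fun a c x => K c x a a) (fun g a b c => hK ..) h hxa.symm hxc.symm h ha.symm hc.symm
  have p14 : ∀ {a c b}, a ≠ c → b ≠ a → b ≠ c →
      K a a c a + K a c c a + ((Fintype.card F : ℂ) - 1) * K a b c a = 0 := fun {a c d} h ha hc =>
    add_add_card_sub_one_mul_eq_zero (by omega) (card_onePoint F)
      (φ := fun x => K a x c a) (h₂ a c a) h fun x hxa hxc =>
      e3 (fun a c x => K a x c a) (fun g a b c => hK ..) h hxa.symm hxc.symm h ha.symm hc.symm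
  have p23 : ∀ {a c b}, a ≠ c → b ≠ a → b ≠ c →
      K c a a a + K c a a c + ((Fintype.card F : ℂ) - 1) * K c a a b = 0 := fun {a c d} h ha hc =>
    add_add_card_sub_one_mul_eq_zero (by omega) (card_onePoint F)
      (φ := fun x => K c a a x) (h₄ c a a) h fun x hxa hxc =>
      e3 (fun a c x => K c a a x) (fun g a b c => hK ..) h hxa.symm hxc.symm h ha.symm hc.symm
  have s12 : ∀ {a c}, a ≠ c → K a a c c = K c c a a := fun {a c} h =>
    e2 (fun a c => K a a c c) (fun g a b => hK ..) h h.symm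
  have s14 : ∀ {a c}, a ≠ c → K a c c a = K c a a c := fun {a c} h =>
    e2 (fun a c => K a c c a) (fun g a b => hK ..) h h.symm
  have s13 : ∀ {a b d}, a ≠ b → a ≠ d → b ≠ d → K a b a d = K a d a b := fun {a b d} h h' h'' =>
    e3 (fun a b d => K a b a d) (fun g a b c => hK ..) h h' h'' h' h h''.symm
  have s24 : ∀ {a b d}, a ≠ b → a ≠ d → b ≠ d → K b a d a = K d a b a := fun {a b d} h h' h'' =>
    e3 (fun a b d => K b a d a) (fun g a b c => hK ..) h h' h'' h' h h''.symm
  have u1 : ∀ {a d}, d ≠ a → K a a a d = K a d a a := fun h =>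
    mul_left_cancel₀ hq0 (by linear_combination t4 h - t2 h)
  have u2 : ∀ {a d}, d ≠ a → K a a d a = K d a a a := fun h =>
    mul_left_cancel₀ hq0 (by linear_combination t3 h - t1 h)
  have v1 : ∀ {a c d}, a ≠ c → d ≠ a → d ≠ c → K a a c d = K c d a a := fun h ha hc =>
    mul_left_cancel₀ hq1 (by
      linear_combination p12 h ha hc - p34 h ha hc - u2 h.symm - s12 h)
  have v2 : ∀ {a c b}, a ≠ c → b ≠ a → b ≠ c → K a b c a = K c a a b := fun h ha hc =>
    mul_left_cancel₀ hq1 (by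
      linear_combination p14 h ha hc - p23 h ha hc - u2 h.symm - s14 h)
  by_cases hab : a = b
  · subst hab
    by_cases hac : a = c
    · subst hac
      by_cases had : a = d
      · subst had; rfl
      · exact u1 (Ne.symm had)
    · by_cases had : d = a
      · subst had; exact u2 (Ne.symm hac)
      · by_cases hcd : d = c
        · subst hcd; exact s12 hac
        · exact v1 hac had hcd
  · by_cases hac : a = c
    · subst hac
      by_cases had : a = d
      · subst had; exact (u1 (Ne.symm hab)).symm
      · by_cases hbd : b = d
        · subst hbd; rfl
        · exact s13 hab had hbd
    · by_cases had : a = d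
      · subst had
        by_cases hbc : b = c
        · subst hbc; exact s14 hab
        · exact v2 hac (Ne.symm hab) hbc
      · by_cases hbc : b = c
        · subst hbc
          by_cases hbd : b = d
          · subst hbd; exact (u2 hab).symm
          · exact (v2 (Ne.symm hab) (Ne.symm hbd) (Ne.symm had)).symm
        · by_cases hbd : b = d
          · subst hbd
            exact s24 (Ne.symm hab) hbc hac
          · by_cases hcd : c = d
            · subst hcd
              exact (v1 (Ne.symm hac) hbc (Ne.symm hab)).symm
            · obtain ⟨g, e₁, e₂, e₃, e₄⟩ := exists_smul_swap hab hac hbc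
                (Ne.symm had) (Ne.symm hbd) (Ne.symm hcd)
              rw [← hK g, e₁, e₂, e₃, e₄]

end Kernel

section Generators

/-- The upper unipotent matrix with off-diagonal entry `x`. -/
def upper (x : F) : Matrix.GeneralLinearGroup (Fin 2) F := mk 1 x 0 1 (by simp)

/-- The lower unipotent matrix with off-diagonal entry `x`. -/
def lower (x : F) : Matrix.GeneralLinearGroup (Fin 2) F := mk 1 0 x 1 (by simp)

/-- The diagonal matrix with entries `a` and `d`. -/
def diag (a d : F) (h : a * d ≠ 0) : Matrix.GeneralLinearGroup (Fin 2) F :=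
  mk a 0 0 d (by simpa using h)

/-- The permutation matrix exchanging the two basis vectors. -/
def weyl : Matrix.GeneralLinearGroup (Fin 2) F := mk 0 1 1 0 (by simp)

lemma upper_mul_upper (x y : F) : upper x * upper y = upper (x + y) := by
  simp only [upper, mk_mul_mk]
  apply mk_congr <;> ring

lemma upper_zero : upper (0 : F) = 1 := by
  apply Units.ext
  simp [upper, coe_mk, Matrix.one_fin_two]

lemma diag_mul_diag (a d a' d' : F) (h : a * d ≠ 0) (h' : a' * d' ≠ 0) :
    diag a d h * diag a' d' h' =
      diag (a * a') (d * d') (by convert mul_ne_zero h h' using 1; ring) := by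
  simp only [diag, mk_mul_mk]
  apply mk_congr <;> ring

lemma weyl_mul_diag (a d : F) (h : a * d ≠ 0) :
    weyl * diag a d h = diag d a (by rwa [mul_comm]) * weyl := by
  simp only [diag, weyl, mk_mul_mk]
  apply mk_congr <;> ring

lemma weyl_mul_upper (x : F) : weyl * upper x = lower x * weyl := by
  simp only [upper, weyl, lower, mk_mul_mk]
  apply mk_congr <;> ring

lemma diag_mul_upper (a d x : F) (h : a * d ≠ 0) :
    diag a d h * upper x = upper (a * x / d) * diag a d h := by
  have := right_ne_zero_of_mul h
  simp only [upper, diag, mk_mul_mk]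
  apply mk_congr <;> field_simp <;> ring

lemma eq_diag_mul_upper (g : Matrix.GeneralLinearGroup (Fin 2) F) (hg : g 1 0 = 0) :
    ∃ a d h x, g = diag a d h * upper x := by
  have h : g 0 0 * g 1 1 ≠ 0 := by
    have := g.det_ne_zero
    rwa [Matrix.det_fin_two, hg, mul_zero, sub_zero] at this
  refine ⟨g 0 0, g 1 1, h, g 0 1 / g 0 0, ?_⟩
  have := left_ne_zero_of_mul h
  conv_lhs => rw [eq_mk g]
  simp only [upper, diag, mk_mul_mk]
  apply mk_congr <;> simp [hg]
  field_simp

/-- Diagonal and unipotent triangular matrices generate `GL₂`. -/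
lemma generators_induction {p : Matrix.GeneralLinearGroup (Fin 2) F → Prop}
    (mul : ∀ g h, p g → p h → p (g * h)) (diagonal : ∀ a d h, p (diag a d h))
    (up : ∀ x, p (upper x)) (low : ∀ x, p (lower x))
    (g : Matrix.GeneralLinearGroup (Fin 2) F) : p g := by
  have key : ∀ (a b c d : F) (h : a * d - b * c ≠ 0), d ≠ 0 → p (mk a b c d h) := by
    intro a b c d h hd
    have h' : (a - b * c / d) * d ≠ 0 := by
      convert h using 1
      field_simp
    have : mk a b c d h = upper (b / d) * (diag (a - b * c / d) d h' * lower (c / d)) := by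
      simp only [upper, diag, lower, mk_mul_mk]
      apply mk_congr <;> field_simp <;> ring
    rw [this]
    exact mul _ _ (up _) (mul _ _ (diagonal _ _ _) (low _))
  rw [eq_mk g]
  by_cases hd : g 1 1 = 0
  · have hdet : g 0 0 * g 1 1 - g 0 1 * g 1 0 ≠ 0 := by
      rw [← Matrix.det_fin_two]; exact g.det_ne_zero
    have hb : g 0 1 ≠ 0 := by
      intro hb
      simp [hb, hd] at hdet
    have : mk (g 0 0) (g 0 1) (g 1 0) (g 1 1) hdet =
        lower (-1) * mk (g 0 0) (g 0 1) (g 0 0 + g 1 0) (g 0 1 + g 1 1)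
          (by convert hdet using 1; ring) := by
      simp only [lower, mk_mul_mk]
      apply mk_congr <;> ring
    rw [this]
    exact mul _ _ (low _) (key _ _ _ _ _ (by simpa [hd]))
  · exact key _ _ _ _ _ hd

end Generators

section Representation

variable {V : Type} [AddCommGroup V] [Module ℂ V]
  (ρ : Representation ℂ (Matrix.GeneralLinearGroup (Fin 2) F) V)

/-- Every endomorphism commuting with the group action is a scalar. -/
def IsSchur {G V : Type} [Group G] [AddCommGroup V] [Module ℂ V] (ρ : Representation ℂ G V) :
    Prop :=
  ∀ T : V →ₗ[ℂ] V, (∀ g, T * ρ g = ρ g * T) → ∃ c : ℂ, T = c • 1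

variable {ρ} in
lemma finrank_le_one_of_upper_eq_one (hρ : IsSchur ρ) (hu : ∀ x, ρ (upper x) = 1) :
    finrank ℂ V ≤ 1 := by
  have hl : ∀ x, ρ (lower x) = 1 := by
    intro x
    have h := congrArg ρ (weyl_mul_upper x)
    rw [map_mul, map_mul, hu, mul_one] at h
    have h2 : ρ weyl * ρ weyl⁻¹ = 1 := by rw [← map_mul, mul_inv_cancel, map_one]
    calc ρ (lower x) = ρ (lower x) * (ρ weyl * ρ weyl⁻¹) := by rw [h2, mul_one]
      _ = 1 := by rw [← mul_assoc, ← h, h2]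
  have hd : ∀ a d h, ∃ c : ℂ, ρ (diag a d h) = c • 1 := by
    intro a d h
    refine hρ _ fun g => ?_
    refine generators_induction (p := fun g => ρ (diag a d h) * ρ g = ρ g * ρ (diag a d h))
      ?_ ?_ ?_ ?_ g
    · intro g g' hg hg'
      rw [map_mul, ← mul_assoc, hg, mul_assoc, hg', mul_assoc]
    · intro a' d' h'
      rw [← map_mul, ← map_mul, diag_mul_diag, diag_mul_diag]
      congr 1
      apply mk_congr <;> ring
    · simp [hu]
    · simp [hl]
  have hg : ∀ g, ∃ c : ℂ, ρ g = c • 1 := by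
    refine generators_induction ?_ hd (fun x => ⟨1, by simp [hu]⟩) (fun x => ⟨1, by simp [hl]⟩)
    rintro g g' ⟨c, hc⟩ ⟨c', hc'⟩
    exact ⟨c * c', by rw [map_mul, hc, hc', smul_mul_smul_comm, mul_one]⟩
  have hT : ∀ T : V →ₗ[ℂ] V, ∃ c : ℂ, T = c • 1 := by
    intro T
    refine hρ T fun g => ?_
    obtain ⟨c, hc⟩ := hg g
    simp [hc]
  by_cases h0 : ∃ v : V, v ≠ 0
  · obtain ⟨v, hv⟩ := h0
    refine finrank_le_one v fun w => ?_
    obtain ⟨f, hf⟩ : ∃ f : Module.Dual ℂ V, f v = 1 := by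
      obtain ⟨f, hf⟩ := not_forall.1 (mt (Module.forall_dual_apply_eq_zero_iff ℂ v).1 hv)
      exact ⟨(f v)⁻¹ • f, by simp [hf]⟩
    obtain ⟨c, hc⟩ := hT (f.smulRight w)
    exact ⟨c, by simpa [hf] using (LinearMap.congr_fun hc v).symm⟩
  · push Not at h0
    exact finrank_le_one 0 fun w => ⟨0, by simp [h0 w]⟩

lemma trace_upper {x : F} (hx : x ≠ 0) :
    LinearMap.trace ℂ V (ρ (upper x)) = LinearMap.trace ℂ V (ρ (upper 1)) := by
  have h : upper x = diag x 1 (by simpa) * upper 1 * (diag x 1 (by simpa))⁻¹ := by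
    rw [diag_mul_upper, mul_inv_cancel_right]; simp
  rw [h, map_mul, LinearMap.trace_mul_comm, ← map_mul, inv_mul_cancel_left]

variable [Fintype F]

/-- The projection onto the subspace on which the upper unipotent matrices act by `ψ⁻¹`. -/
def psiProj (ψ : AddChar F ℂ) : V →ₗ[ℂ] V :=
  (Fintype.card F : ℂ)⁻¹ • ∑ x, ψ x • ρ (upper x)

lemma isIdempotentElem_psiProj (ψ : AddChar F ℂ) : IsIdempotentElem (psiProj ρ ψ) := by
  have hq : (Fintype.card F : ℂ) ≠ 0 := by exact_mod_cast Fintype.card_ne_zero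
  have h : ∀ x, ψ x • ρ (upper x) * ∑ y, ψ y • ρ (upper y) = ∑ y, ψ y • ρ (upper y) := by
    intro x
    rw [Finset.mul_sum]
    refine Fintype.sum_equiv (Equiv.addLeft x) _ _ fun y => ?_
    rw [Equiv.coe_addLeft, smul_mul_smul_comm, ← map_mul ρ, upper_mul_upper, AddChar.map_add_eq_mul]
  rw [IsIdempotentElem, psiProj, smul_mul_smul_comm, Finset.sum_mul,
    Finset.sum_congr rfl fun x _ => h x, Finset.sum_const, Finset.card_univ,
    ← Nat.cast_smul_eq_nsmul ℂ, smul_smul]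
  congr 1
  field_simp

lemma upper_mul_psiProj_one (x : F) : ρ (upper x) * psiProj ρ 1 = psiProj ρ 1 := by
  rw [psiProj, mul_smul_comm, Finset.mul_sum]
  congr 1
  refine Fintype.sum_equiv (Equiv.addLeft x) _ _ fun y => ?_
  simp [← map_mul, upper_mul_upper]

variable [FiniteDimensional ℂ V]

lemma card_mul_trace_psiProj (ψ : AddChar F ℂ) :
    (Fintype.card F : ℂ) * LinearMap.trace ℂ V (psiProj ρ ψ) =
      finrank ℂ V + (∑ x, ψ x - 1) * LinearMap.trace ℂ V (ρ (upper 1)) := by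
  classical
  have hq : (Fintype.card F : ℂ) ≠ 0 := by exact_mod_cast Fintype.card_ne_zero
  rw [psiProj, map_smul, smul_eq_mul, mul_inv_cancel_left₀ hq, map_sum,
    ← Finset.add_sum_erase _ _ (Finset.mem_univ 0),
    ← Finset.add_sum_erase _ (fun x => ψ x) (Finset.mem_univ 0)]
  rw [Finset.sum_congr rfl fun x hx => by
    rw [map_smul, trace_upper ρ (Finset.ne_of_mem_erase hx), smul_eq_mul], ← Finset.sum_mul]
  simp [upper_zero, LinearMap.trace_one]

variable {ρ}

lemma finrank_range_psiProj_one (hρ : IsSchur ρ) (hq : 3 ≤ Fintype.card F)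
    (hV : finrank ℂ V = Fintype.card F) : finrank ℂ (LinearMap.range (psiProj ρ 1)) = 1 := by
  obtain ⟨ψ, hψ⟩ : ∃ ψ : AddChar F ℂ, ψ 1 ≠ 1 := AddChar.exists_apply_ne_zero.2 one_ne_zero
  have hψ1 : ψ ≠ 1 := by rintro rfl; simp at hψ
  have e1 := card_mul_trace_psiProj ρ 1
  have e2 := card_mul_trace_psiProj ρ ψ
  rw [AddChar.sum_eq_zero_of_ne_one hψ1] at e2
  rw [(LinearMap.IsIdempotentElem.isProj_range _ (isIdempotentElem_psiProj ρ _)).trace, hV] at e1 e2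
  simp only [AddChar.one_apply, Finset.sum_const, Finset.card_univ, nsmul_eq_mul, mul_one] at e1
  have hq0 : (Fintype.card F : ℂ) ≠ 0 := by exact_mod_cast Fintype.card_ne_zero
  set m := finrank ℂ (LinearMap.range (psiProj ρ ψ)) with hm
  set d := finrank ℂ (LinearMap.range (psiProj ρ 1)) with hd
  have e3 : (d : ℂ) + (Fintype.card F - 1) * m = Fintype.card F := by
    apply mul_left_cancel₀ hq0
    linear_combination e1 + (Fintype.card F - 1) * e2
  obtain ⟨n, hn⟩ : ∃ n, Fintype.card F = n + 1 := ⟨Fintype.card F - 1, by omega⟩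
  rw [hn] at e3
  push_cast at e3
  rw [add_sub_cancel_right] at e3
  have e4 : d + n * m = n + 1 := by exact_mod_cast e3
  have hm1 : m = 1 := by
    obtain h | h | h : m = 0 ∨ m = 1 ∨ 2 ≤ m := by omega
    · exfalso
      have htop : LinearMap.range (psiProj ρ 1) = ⊤ := by
        apply Submodule.eq_top_of_finrank_eq
        rw [hV, ← hd, hn]
        simpa [h] using e4
      have hid : psiProj ρ 1 = 1 := by
        ext v
        obtain ⟨w, rfl⟩ := LinearMap.range_eq_top.1 htop v
        exact LinearMap.congr_fun (isIdempotentElem_psiProj ρ 1) w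
      have := finrank_le_one_of_upper_eq_one hρ fun x => by
        simpa [hid] using upper_mul_psiProj_one ρ x
      omega
    · exact h
    · have := Nat.mul_le_mul_left n h
      omega
  rw [hm1] at e4
  omega

end Representation

lemma char_ne_zero {G : Type*} [Group G] (μ : G →* ℂ) (g : G) : μ g ≠ 0 := by
  intro h
  have : μ (g * g⁻¹) = 0 := by rw [map_mul, h, zero_mul]
  simp at this

section Borel

variable {V : Type} [AddCommGroup V] [Module ℂ V]
  {ρ : Representation ℂ (Matrix.GeneralLinearGroup (Fin 2) F) V}

lemma trace_diag_mul_upper {a d : F} (h : a * d ≠ 0) (had : a ≠ d) (x : F) :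
    LinearMap.trace ℂ V (ρ (diag a d h * upper x)) = LinearMap.trace ℂ V (ρ (diag a d h)) := by
  have had' : d - a ≠ 0 := sub_ne_zero.2 had.symm
  have hd : d ≠ 0 := right_ne_zero_of_mul h
  have key : diag a d h * upper x =
      upper (a * x / (d - a)) * diag a d h * (upper (a * x / (d - a)))⁻¹ := by
    rw [eq_mul_inv_iff_mul_eq, mul_assoc, upper_mul_upper, diag_mul_upper]
    congr 2
    field_simp
    ring
  rw [key, map_mul, LinearMap.trace_mul_comm, ← map_mul, inv_mul_cancel_left]

variable [Fintype F]

lemma diag_mul_psiProj_one (a d : F) (h : a * d ≠ 0) :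
    ρ (diag a d h) * psiProj ρ 1 = psiProj ρ 1 * ρ (diag a d h) := by
  have ha : a ≠ 0 := left_ne_zero_of_mul h
  have hd : d ≠ 0 := right_ne_zero_of_mul h
  rw [psiProj, mul_smul_comm, smul_mul_assoc, Finset.mul_sum, Finset.sum_mul]
  congr 1
  refine Fintype.sum_equiv (Equiv.mulLeft₀ (a / d) (div_ne_zero ha hd)) _ _ fun x => ?_
  simp only [AddChar.one_apply, one_smul, Equiv.mulLeft₀_apply, ← map_mul, diag_mul_upper]
  congr 3
  ring

variable [FiniteDimensional ℂ V]

lemma exists_borel_eigenvector (hρ : IsSchur ρ) (hq : 3 ≤ Fintype.card F)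
    (hV : finrank ℂ V = Fintype.card F) :
    ∃ (μ : Matrix.GeneralLinearGroup (Fin 2) F →* ℂ) (v : V) (ℓ : V →ₗ[ℂ] ℂ), ℓ v = 1 ∧
      ∀ b : Matrix.GeneralLinearGroup (Fin 2) F, b 1 0 = 0 →
        ρ b v = μ b • v ∧ ∀ y, ℓ (ρ b y) = μ b * ℓ y := by
  obtain ⟨v₀, hv₀, hspan⟩ := finrank_eq_one_iff'.1 (finrank_range_psiProj_one hρ hq hV)
  obtain ⟨v, z, hz⟩ := v₀
  have hv : v ≠ 0 := fun h => hv₀ (Subtype.ext h)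
  have hPv : psiProj ρ 1 v = v := by
    rw [← hz]
    exact LinearMap.congr_fun (isIdempotentElem_psiProj ρ 1) z
  obtain ⟨ℓ, hℓv, hℓ⟩ : ∃ ℓ : V →ₗ[ℂ] ℂ, ℓ v = 1 ∧ ∀ y, psiProj ρ 1 y = ℓ y • v := by
    obtain ⟨f, hf⟩ := not_forall.1 (mt (Module.forall_dual_apply_eq_zero_iff ℂ v).1 hv)
    refine ⟨(f v)⁻¹ • f ∘ₗ psiProj ρ 1, by simp [hPv, hf], fun y => ?_⟩
    obtain ⟨c, hc⟩ := hspan ⟨psiProj ρ 1 y, y, rfl⟩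
    have hc' : c • v = psiProj ρ 1 y := congrArg Subtype.val hc
    simp [← hc', hf, mul_comm c]
  have hu : ∀ x, ρ (upper x) v = v := fun x => by
    rw [← hPv]
    exact LinearMap.congr_fun (upper_mul_psiProj_one ρ x) v
  have hd : ∀ a d h, ρ (diag a d h) v = ℓ (ρ (diag a d h) v) • v := fun a d h => by
    rw [← hℓ]
    conv_lhs => rw [← hPv]
    exact LinearMap.congr_fun (diag_mul_psiProj_one a d h) v
  have hlu : ∀ x y, ℓ (ρ (upper x) y) = ℓ y := fun x y => by
    have h : psiProj ρ 1 * ρ (upper x) = psiProj ρ 1 := by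
      rw [psiProj, smul_mul_assoc, Finset.sum_mul]
      congr 1
      refine Fintype.sum_equiv (Equiv.addRight x) _ _ fun y => ?_
      simp [← map_mul, upper_mul_upper]
    have := LinearMap.congr_fun h y
    rw [Module.End.mul_apply, hℓ, hℓ] at this
    exact smul_left_injective ℂ hv this
  have hld : ∀ a d h y, ℓ (ρ (diag a d h) y) = ℓ (ρ (diag a d h) v) * ℓ y := fun a d h y => by
    have := LinearMap.congr_fun (diag_mul_psiProj_one (ρ := ρ) a d h) y
    rw [Module.End.mul_apply, Module.End.mul_apply, hℓ, hℓ, map_smul, hd, smul_smul] at this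
    rw [mul_comm]
    exact (smul_left_injective ℂ hv this).symm
  have htr : ∀ a d h, a ≠ d →
      LinearMap.trace ℂ V (ρ (diag a d h)) = ℓ (ρ (diag a d h) v) := fun a d h had => by
    have h1 : LinearMap.trace ℂ V (ρ (diag a d h) * psiProj ρ 1) =
        LinearMap.trace ℂ V (ρ (diag a d h)) := by
      have hq0 : (Fintype.card F : ℂ) ≠ 0 := by exact_mod_cast Fintype.card_ne_zero
      simp [psiProj, Finset.mul_sum, ← map_mul, trace_diag_mul_upper h had, hq0]
    have h2 : ρ (diag a d h) * psiProj ρ 1 = ℓ.smulRight (ρ (diag a d h) v) := by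
      ext y
      simp [hℓ]
    rw [← h1, h2, LinearMap.trace_smulRight]
  have hsymm : ∀ a (h : a * 1 ≠ 0) (h' : 1 * a ≠ 0),
      ℓ (ρ (diag a 1 h) v) = ℓ (ρ (diag 1 a h') v) := fun a h h' => by
    by_cases ha : a = 1
    · subst ha; rfl
    · rw [← htr _ _ _ ha, ← htr _ _ _ (Ne.symm ha)]
      have : diag 1 a h' = weyl * diag a 1 h * weyl⁻¹ := by
        rw [weyl_mul_diag, mul_inv_cancel_right]
      rw [this, map_mul, LinearMap.trace_mul_comm, ← map_mul, inv_mul_cancel_left]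
  have hdet : ∀ g : Matrix.GeneralLinearGroup (Fin 2) F,
      (g : Matrix (Fin 2) (Fin 2) F).det * 1 ≠ 0 :=
    fun g => mul_ne_zero g.det_ne_zero one_ne_zero
  have hmul : ∀ a d h a' d' h' h'', ℓ (ρ (diag (a * a') (d * d') h'') v) =
      ℓ (ρ (diag a d h) v) * ℓ (ρ (diag a' d' h') v) := fun a d h a' d' h' h'' => by
    rw [← hld, ← Module.End.mul_apply, ← map_mul, diag_mul_diag]
  refine ⟨⟨⟨fun g => ℓ (ρ (diag (g : Matrix (Fin 2) (Fin 2) F).det 1 (hdet g)) v), ?_⟩, ?_⟩,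
    v, ℓ, hℓv, ?_⟩
  · have : diag (1 : F) 1 (by simp) = 1 := Units.ext (by simp [diag, coe_mk, Matrix.one_fin_two])
    simp [this, hℓv]
  · intro g g'
    have h := hmul _ 1 (hdet g) _ 1 (hdet g')
      (mul_ne_zero (mul_ne_zero g.det_ne_zero g'.det_ne_zero) (mul_ne_zero one_ne_zero one_ne_zero))
    simpa using h
  · intro b hb
    obtain ⟨a, d, h, x, rfl⟩ := eq_diag_mul_upper b hb
    have hμ : ℓ (ρ (diag ((diag a d h * upper x : Matrix.GeneralLinearGroup (Fin 2) F) :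
        Matrix (Fin 2) (Fin 2) F).det 1 (hdet _)) v) = ℓ (ρ (diag a d h) v) := by
      have e1 : ((diag a d h * upper x : Matrix.GeneralLinearGroup (Fin 2) F) :
          Matrix (Fin 2) (Fin 2) F).det = a * d := by
        simp [diag, upper, coe_mk]
      have ha : a ≠ 0 := left_ne_zero_of_mul h
      have hd : d ≠ 0 := right_ne_zero_of_mul h
      simp only [e1]
      have e2 := hmul a 1 (by simpa) d 1 (by simpa) (by simpa using h)
      have e3 := hmul a 1 (by simpa) 1 d (by simpa) (by simpa using h)
      rw [hsymm d _ (by simpa), ← e3] at e2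
      simpa using e2
    constructor
    · rw [map_mul, Module.End.mul_apply, hu, hd]
      exact congrArg (· • v) hμ.symm
    · intro y
      rw [map_mul, Module.End.mul_apply, hld, hlu]
      exact congrArg (· * ℓ y) hμ.symm

end Borel

section Frame

variable [DecidableEq F] [Fintype F] {V : Type} [AddCommGroup V] [Module ℂ V]

/-- A system of vectors and covectors indexed by the projective line, permuted by `GL₂` up to the
linear character `μ`, which exhibits a representation as a summand of a twist by `μ` of the
permutation representation on the projective line. -/
structure SteinbergFrame (ρ : Representation ℂ (Matrix.GeneralLinearGroup (Fin 2) F) V) where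
  /-- The twisting character. -/
  μ : Matrix.GeneralLinearGroup (Fin 2) F →* ℂ
  /-- The vector attached to a point. -/
  vec : OnePoint F → V
  /-- The covector attached to a point. -/
  coord : OnePoint F → V →ₗ[ℂ] ℂ
  /-- The scalar by which the frame operator acts. -/
  c : ℂ
  c_ne_zero : c ≠ 0
  map_vec : ∀ g x, ρ g (vec x) = μ g • vec (g • x)
  coord_map : ∀ g x y, coord (g • x) (ρ g y) = μ g * coord x y
  sum_vec : ∑ x, vec x = 0
  sum_coord : ∑ x, coord x = 0
  sum_coord_smul_vec : ∀ y, ∑ x, coord x y • vec x = c • y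
  coord_infty_vec_infty : coord ∞ (vec ∞) = 1

variable {ρ : Representation ℂ (Matrix.GeneralLinearGroup (Fin 2) F) V}

variable [FiniteDimensional ℂ V]

theorem nonempty_steinbergFrame (hρ : IsSchur ρ) (hq : 3 ≤ Fintype.card F)
    (hV : finrank ℂ V = Fintype.card F) : Nonempty (SteinbergFrame ρ) := by
  obtain ⟨μ, v, ℓ, hℓv, hb⟩ := exists_borel_eigenvector hρ hq hV
  choose σ hσ using exists_smul_infty (F := F)
  have hb' : ∀ g, ((σ (g • ∞))⁻¹ * g) 1 0 = 0 := fun g => by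
    rw [← OnePoint.smul_infty_eq_self_iff, mul_smul, inv_smul_eq_iff, hσ]
  have hμ := char_ne_zero μ
  have hμi : ∀ g h, μ (g⁻¹ * h) = (μ g)⁻¹ * μ h := fun g h => by
    rw [eq_inv_mul_iff_mul_eq₀ (hμ g), ← map_mul, mul_inv_cancel_left]
  let vec : OnePoint F → V := fun x => (μ (σ x))⁻¹ • ρ (σ x) v
  let coord : OnePoint F → V →ₗ[ℂ] ℂ := fun x => μ (σ x) • ℓ ∘ₗ ρ (σ x)⁻¹
  have hvec : ∀ g, ρ g v = μ g • vec (g • ∞) := fun g => by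
    have := congrArg (ρ (σ (g • ∞))) (hb _ (hb' g)).1
    rw [← Module.End.mul_apply, ← map_mul, mul_inv_cancel_left, map_smul, hμi] at this
    rw [this, smul_smul, mul_comm]
  have hcoord : ∀ g y, coord (g • ∞) (ρ g y) = μ g * ℓ y := fun g y => by
    have := (hb _ (hb' g)).2 y
    rw [map_mul, Module.End.mul_apply, hμi, mul_assoc, eq_inv_mul_iff_mul_eq₀ (hμ _)] at this
    simpa [coord] using this
  have hgv : ∀ g x, ρ g (vec x) = μ g • vec (g • x) := fun g x => by
    have h := hvec (g * σ x)
    rw [map_mul, map_mul, Module.End.mul_apply, mul_smul (α := Matrix.GeneralLinearGroup (Fin 2) F),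
      hσ, mul_comm, ← smul_smul] at h
    rw [map_smul, h, smul_smul, inv_mul_cancel₀ (hμ _), one_smul]
  have hgc : ∀ g x y, coord (g • x) (ρ g y) = μ g * coord x y := fun g x y => by
    have h := hcoord (g * σ x) (ρ (σ x)⁻¹ y)
    rw [mul_smul, hσ, ← Module.End.mul_apply, ← map_mul, mul_inv_cancel_right, map_mul] at h
    rw [h, mul_assoc]
    rfl
  have hcv : coord ∞ (vec ∞) = 1 := by
    have h := hcoord (σ ∞) v
    rw [hσ, hℓv, mul_one] at h
    simp [vec, h, hμ]
  have hcvx : ∀ x, coord x (vec x) = 1 := fun x => by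
    have h := hgc (σ x) ∞ (vec ∞)
    rw [hgv, hσ, map_smul, hcv, mul_one, smul_eq_mul] at h
    simpa [hμ] using h
  let E : V →ₗ[ℂ] V := ∑ x, (coord x).smulRight (vec x)
  have hE : ∀ y, E y = ∑ x, coord x y • vec x := fun y => by simp [E]
  obtain ⟨c, hc⟩ := hρ E fun g => by
    ext y
    rw [Module.End.mul_apply, Module.End.mul_apply, hE, hE, map_sum]
    refine (Fintype.sum_equiv (MulAction.toPerm g) _ _ fun x => ?_).symm
    rw [MulAction.toPerm_apply, hgc, map_smul, hgv, smul_smul, mul_comm]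
  have hE' : ∀ y, ∑ x, coord x y • vec x = c • y := fun y => by
    rw [← hE, hc]; rfl
  have hc0 : c ≠ 0 := by
    rintro rfl
    have h : LinearMap.trace ℂ V E = 0 := by rw [hc]; simp
    simp only [E, map_sum, LinearMap.trace_smulRight, hcvx, Finset.sum_const, Finset.card_univ,
      nsmul_eq_mul, mul_one, card_onePoint] at h
    norm_cast at h
  -- the sums of all vectors and of all covectors are semi-invariant
  have hz : ∀ g, ρ g (∑ x, vec x) = μ g • ∑ x, vec x := fun g => by
    rw [map_sum, Finset.smul_sum]
    refine Fintype.sum_equiv (MulAction.toPerm g) _ _ fun x => ?_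
    rw [MulAction.toPerm_apply, hgv]
  have hL : ∀ g y, (∑ x, coord x) (ρ g y) = μ g * (∑ x, coord x) y := fun g y => by
    rw [LinearMap.sum_apply, LinearMap.sum_apply, Finset.mul_sum]
    refine (Fintype.sum_equiv (MulAction.toPerm g) _ _ fun x => ?_).symm
    rw [MulAction.toPerm_apply, hgc]
  obtain ⟨k, hk⟩ := hρ ((∑ x, coord x).smulRight (∑ x, vec x)) fun g => by
    ext y
    rw [Module.End.mul_apply, Module.End.mul_apply, LinearMap.smulRight_apply,
      LinearMap.smulRight_apply, hL, map_smul, hz, smul_smul, mul_comm]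
  have hk0 : k = 0 := by
    by_contra hk0
    have : finrank ℂ V ≤ 1 := finrank_le_one (∑ x, vec x) fun y =>
      ⟨k⁻¹ * (∑ x, coord x) y, by
        rw [← smul_smul, ← LinearMap.smulRight_apply, hk]
        simp [smul_smul, hk0]⟩
    omega
  have hq1 : ((Fintype.card F + 1 : ℕ) : ℂ) ≠ 0 := by
    exact_mod_cast Nat.succ_ne_zero (Fintype.card F)
  have hzc : ∀ x, coord x (∑ x, vec x) = coord ∞ (∑ x, vec x) := fun x => by
    have h := hgc (σ x) ∞ (∑ x, vec x)
    rw [hσ, hz, map_smul, smul_eq_mul] at h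
    exact mul_left_cancel₀ (hμ _) h
  have hLv : ∀ x, (∑ x, coord x) (vec x) = (∑ x, coord x) (vec ∞) := fun x => by
    have h := hL (σ x) (vec ∞)
    rw [hgv, hσ, map_smul, smul_eq_mul] at h
    exact mul_left_cancel₀ (hμ _) h
  have hLz : (∑ x, coord x) (∑ x, vec x) = 0 := by
    have h := congrArg (LinearMap.trace ℂ V) hk
    rw [LinearMap.trace_smulRight, hk0] at h
    simpa using h
  have hz0 : ∑ x, vec x = 0 := by
    have h := hLz
    rw [LinearMap.sum_apply, Finset.sum_congr rfl fun x _ => hzc x, Finset.sum_const,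
      Finset.card_univ, card_onePoint, nsmul_eq_mul] at h
    have h0 := (mul_eq_zero.1 h).resolve_left hq1
    have h1 := hE' (∑ x, vec x)
    rw [Finset.sum_congr rfl fun x _ => by rw [hzc x, h0, zero_smul], Finset.sum_const_zero] at h1
    exact (smul_eq_zero.1 h1.symm).resolve_left hc0
  have hL0 : ∑ x, coord x = 0 := by
    have h := hLz
    rw [map_sum, Finset.sum_congr rfl fun x _ => hLv x, Finset.sum_const,
      Finset.card_univ, card_onePoint, nsmul_eq_mul] at h
    have h0 := (mul_eq_zero.1 h).resolve_left hq1
    ext y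
    have h1 := congrArg (⇑(∑ x, coord x)) (hE' y)
    rw [map_sum, map_smul, Finset.sum_congr rfl fun x _ => by
      rw [map_smul, hLv x, h0, smul_zero], Finset.sum_const_zero] at h1
    exact (smul_eq_zero.1 h1.symm).resolve_left hc0
  exact ⟨⟨μ, vec, coord, c, hc0, hgv, hgc, hz0, hL0, hE', hcv⟩⟩

end Frame

section Characters

variable [Fintype F] (χ : Matrix.GeneralLinearGroup (Fin 2) F →* ℂ)

lemma char_upper (hq : 3 ≤ Fintype.card F) (x : F) : χ (upper x) = 1 := by
  classical
  obtain ⟨a, ha⟩ : ∃ a, a ∉ ({0, 1} : Finset F) := by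
    by_contra! h
    have := Finset.card_le_card fun x (_ : x ∈ (Finset.univ : Finset F)) => h x
    have := Finset.card_le_two (a := (0 : F)) (b := 1)
    rw [Finset.card_univ] at *
    omega
  simp only [Finset.mem_insert, Finset.mem_singleton, not_or] at ha
  have ha1 : a - 1 ≠ 0 := sub_ne_zero.2 ha.2
  have h := congrArg χ (diag_mul_upper a 1 (x / (a - 1)) (by simpa using ha.1))
  have hx : a * (x / (a - 1)) / 1 = x + x / (a - 1) := by
    field_simp
    ring
  rw [hx, ← upper_mul_upper, map_mul, map_mul, map_mul, mul_comm] at h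
  have h1 := mul_right_cancel₀ (char_ne_zero χ _) h
  exact mul_right_cancel₀ (char_ne_zero χ _) (h1.symm.trans (one_mul _).symm)

lemma char_lower (hq : 3 ≤ Fintype.card F) (x : F) : χ (lower x) = 1 := by
  have h := congrArg χ (weyl_mul_upper x)
  rw [map_mul, map_mul, char_upper χ hq, mul_comm] at h
  exact (mul_right_cancel₀ (char_ne_zero χ _) h).symm

lemma char_ext (hq : 3 ≤ Fintype.card F) {χ χ' : Matrix.GeneralLinearGroup (Fin 2) F →* ℂ}
    (h : ∀ a d had, χ (diag a d had) = χ' (diag a d had)) : χ = χ' := by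
  refine MonoidHom.ext (generators_induction ?_ h ?_ ?_)
  · intro g g' hg hg'
    rw [map_mul, map_mul, hg, hg']
  · intro x
    rw [char_upper χ hq, char_upper χ' hq]
  · intro x
    rw [char_lower χ hq, char_lower χ' hq]

end Characters

section Tensor

variable [DecidableEq F] [Fintype F] {V W : Type} [AddCommGroup V] [Module ℂ V]
  [AddCommGroup W] [Module ℂ W]
  {ρ : Representation ℂ (Matrix.GeneralLinearGroup (Fin 2) F) V}
  {σ : Representation ℂ (Matrix.GeneralLinearGroup (Fin 2) F) W}

namespace SteinbergFrame

variable (D : SteinbergFrame ρ) (E : SteinbergFrame σ)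

/-- The tensor product of two frame vectors. -/
def vec₂ (a b : OnePoint F) : TensorProduct ℂ V W := TensorProduct.tmul ℂ (D.vec a) (E.vec b)

/-- The tensor product of two frame covectors. -/
def coord₂ (a b : OnePoint F) : TensorProduct ℂ V W →ₗ[ℂ] ℂ :=
  LinearMap.mul' ℂ ℂ ∘ₗ TensorProduct.map (D.coord a) (E.coord b)

lemma coord₂_tmul (a b : OnePoint F) (v : V) (w : W) :
    coord₂ D E a b (TensorProduct.tmul ℂ v w) = D.coord a v * E.coord b w := by
  simp [coord₂]

lemma tprod_vec₂ (g : Matrix.GeneralLinearGroup (Fin 2) F) (a b : OnePoint F) :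
    ρ.tprod σ g (vec₂ D E a b) = (D.μ * E.μ) g • vec₂ D E (g • a) (g • b) := by
  rw [vec₂, Representation.tprod_apply, TensorProduct.map_tmul, D.map_vec, E.map_vec,
    TensorProduct.smul_tmul_smul]
  rfl

lemma coord₂_tprod (g : Matrix.GeneralLinearGroup (Fin 2) F) (a b : OnePoint F)
    (z : TensorProduct ℂ V W) :
    coord₂ D E (g • a) (g • b) (ρ.tprod σ g z) = (D.μ * E.μ) g * coord₂ D E a b z := by
  induction z with
  | zero => simp
  | add x y hx hy => rw [map_add, map_add, hx, hy, map_add, mul_add]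
  | tmul v w =>
    simp only [Representation.tprod_apply, TensorProduct.map_tmul, coord₂_tmul, D.coord_map,
      E.coord_map, MonoidHom.mul_apply]
    ring

lemma sum_coord₂_smul_vec₂ (z : TensorProduct ℂ V W) :
    ∑ a, ∑ b, coord₂ D E a b z • vec₂ D E a b = (D.c * E.c) • z := by
  induction z with
  | zero => simp
  | add x y hx hy => simp only [map_add, add_smul, Finset.sum_add_distrib, hx, hy, smul_add]
  | tmul v w =>
    rw [← TensorProduct.smul_tmul_smul, ← D.sum_coord_smul_vec, ← E.sum_coord_smul_vec,
      TensorProduct.sum_tmul]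
    simp only [TensorProduct.tmul_sum, TensorProduct.smul_tmul_smul, coord₂_tmul, vec₂]

lemma sum_vec₂_left (b : OnePoint F) : ∑ a, vec₂ D E a b = 0 := by
  simp [vec₂, ← TensorProduct.sum_tmul, D.sum_vec]

lemma sum_vec₂_right (a : OnePoint F) : ∑ b, vec₂ D E a b = 0 := by
  simp [vec₂, ← TensorProduct.tmul_sum, E.sum_vec]

lemma sum_coord₂_left (b : OnePoint F) (z : TensorProduct ℂ V W) :
    ∑ a, coord₂ D E a b z = 0 := by
  induction z with
  | zero => simp
  | add x y hx hy => simp only [map_add, Finset.sum_add_distrib, hx, hy, add_zero]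
  | tmul v w =>
    simp [coord₂_tmul, ← Finset.sum_mul, ← LinearMap.sum_apply, D.sum_coord]

lemma sum_coord₂_right (a : OnePoint F) (z : TensorProduct ℂ V W) :
    ∑ b, coord₂ D E a b z = 0 := by
  induction z with
  | zero => simp
  | add x y hx hy => simp only [map_add, Finset.sum_add_distrib, hx, hy, add_zero]
  | tmul v w =>
    simp [coord₂_tmul, ← Finset.mul_sum, ← LinearMap.sum_apply, E.sum_coord]

lemma eq_zero_of_coord₂ {z : TensorProduct ℂ V W} (h : ∀ a b, coord₂ D E a b z = 0) : z = 0 := by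
  have := sum_coord₂_smul_vec₂ D E z
  simp only [h, zero_smul, Finset.sum_const_zero] at this
  exact (smul_eq_zero.1 this.symm).resolve_left (mul_ne_zero D.c_ne_zero E.c_ne_zero)

lemma coord₂_map_vec₂_symm (hq : 3 ≤ Fintype.card F)
    {T : TensorProduct ℂ V W →ₗ[ℂ] TensorProduct ℂ V W}
    (hT : ∀ g, T * ρ.tprod σ g = ρ.tprod σ g * T) (a b c d : OnePoint F) :
    coord₂ D E c d (T (vec₂ D E a b)) = coord₂ D E a b (T (vec₂ D E c d)) := by
  refine kernel_symm hq (fun a b c d => coord₂ D E c d (T (vec₂ D E a b))) ?_ ?_ ?_ ?_ ?_ a b c d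
  · intro g a b c d
    have h := coord₂_tprod D E g c d (T (vec₂ D E a b))
    rw [← Module.End.mul_apply, ← hT, Module.End.mul_apply, tprod_vec₂, map_smul, map_smul,
      smul_eq_mul] at h
    exact mul_left_cancel₀ (char_ne_zero _ g) h
  · intro b c d
    simp only [← map_sum, sum_vec₂_left, map_zero]
  · intro a c d
    simp only [← map_sum, sum_vec₂_right, map_zero]
  · intro a b d
    exact sum_coord₂_left D E d _
  · intro a b c
    exact sum_coord₂_right D E c _

/-- The algebra of endomorphisms of a tensor product of two `q`-dimensional irreducible
representations is commutative. -/
theorem commute_of_equivariant (D : SteinbergFrame ρ) (E : SteinbergFrame σ)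
    (hq : 3 ≤ Fintype.card F)
    {S T : TensorProduct ℂ V W →ₗ[ℂ] TensorProduct ℂ V W}
    (hS : ∀ g, S * ρ.tprod σ g = ρ.tprod σ g * S) (hT : ∀ g, T * ρ.tprod σ g = ρ.tprod σ g * T) :
    S * T = T * S := by
  have hc := mul_ne_zero D.c_ne_zero E.c_ne_zero
  have hcomp : ∀ (A B : TensorProduct ℂ V W →ₗ[ℂ] TensorProduct ℂ V W) a b c d,
      ∑ e, ∑ f, coord₂ D E e f (A (vec₂ D E a b)) * coord₂ D E c d (B (vec₂ D E e f)) =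
        D.c * E.c * coord₂ D E c d ((B * A) (vec₂ D E a b)) := fun A B a b c d => by
    have h := congrArg (fun z => coord₂ D E c d (B z))
      (sum_coord₂_smul_vec₂ D E (A (vec₂ D E a b)))
    simpa only [map_sum, map_smul, smul_eq_mul, Module.End.mul_apply] using h
  have hTS : ∀ g, (T * S) * ρ.tprod σ g = ρ.tprod σ g * (T * S) := fun g => by
    rw [mul_assoc, hS, ← mul_assoc, hT, mul_assoc]
  have hvec : ∀ a b, (S * T) (vec₂ D E a b) = (T * S) (vec₂ D E a b) := fun a b => by
    rw [← sub_eq_zero]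
    refine eq_zero_of_coord₂ D E fun c d => ?_
    rw [map_sub, sub_eq_zero]
    refine mul_left_cancel₀ hc ?_
    rw [coord₂_map_vec₂_symm D E hq hTS a b c d, ← hcomp, ← hcomp]
    refine Finset.sum_congr rfl fun e _ => Finset.sum_congr rfl fun f _ => ?_
    rw [coord₂_map_vec₂_symm D E hq hT a b e f, coord₂_map_vec₂_symm D E hq hS e f c d, mul_comm]
  refine LinearMap.ext fun z => smul_right_injective _ hc ?_
  simp only [← map_smul, ← sum_coord₂_smul_vec₂ D E z]
  simp only [map_sum, map_smul, hvec]

lemma one_add_card_mul_coord_infty_vec {x : OnePoint F} (hx : x ≠ ∞) :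
    1 + (Fintype.card F : ℂ) * D.coord ∞ (D.vec x) = 0 := by
  rw [← D.coord_infty_vec_infty]
  refine add_card_mul_eq_zero (φ := fun x => D.coord ∞ (D.vec x)) (card_onePoint F) ?_ ?_
  · rw [← map_sum, D.sum_vec, map_zero]
  · intro y hy
    obtain ⟨g, hg, hgx⟩ := exists_smul_infty_zero hx.symm
    obtain ⟨h, hh, hhy⟩ := exists_smul_infty_zero hy.symm
    have e : ∀ (g : Matrix.GeneralLinearGroup (Fin 2) F) (x y : OnePoint F),
        D.coord (g • x) (D.vec (g • y)) = D.coord x (D.vec y) := fun g x y => by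
      have := D.coord_map g x (D.vec y)
      rw [D.map_vec, map_smul, smul_eq_mul] at this
      exact mul_left_cancel₀ (char_ne_zero _ g) this
    have e1 := e g ∞ ((0 : F) : OnePoint F)
    have e2 := e h ∞ ((0 : F) : OnePoint F)
    rw [hg, hgx] at e1
    rw [hh, hhy] at e2
    exact e2.trans e1.symm

lemma sum_vec₂_diagonal_ne_zero : ∑ x, vec₂ D E x x ≠ 0 := by
  intro h
  have hq0 : (Fintype.card F : ℂ) ≠ 0 := Nat.cast_ne_zero.2 Fintype.card_ne_zero
  have h1 := congrArg (coord₂ D E ∞ ∞) h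
  have h2 : ∀ x : F, coord₂ D E ∞ ∞ (vec₂ D E x x) = (1 / (Fintype.card F : ℂ)) ^ 2 := fun x => by
    have e1 := D.one_add_card_mul_coord_infty_vec (OnePoint.coe_ne_infty x)
    have e2 := E.one_add_card_mul_coord_infty_vec (OnePoint.coe_ne_infty x)
    rw [vec₂, coord₂_tmul, eq_div_of_mul_eq hq0 (by linear_combination e1 :
      D.coord ∞ (D.vec x) * (Fintype.card F : ℂ) = -1), eq_div_of_mul_eq hq0 (by
      linear_combination e2 : E.coord ∞ (E.vec x) * (Fintype.card F : ℂ) = -1)]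
    ring
  have h3 : coord₂ D E ∞ ∞ (vec₂ D E ∞ ∞) = 1 := by
    rw [vec₂, coord₂_tmul, D.coord_infty_vec_infty, E.coord_infty_vec_infty, one_mul]
  have h4 : ∑ x, coord₂ D E ∞ ∞ (vec₂ D E x x) =
      coord₂ D E ∞ ∞ (vec₂ D E ∞ ∞) + ∑ x : F, coord₂ D E ∞ ∞ (vec₂ D E x x) :=
    Fintype.sum_option _
  rw [map_sum, map_zero, h4, h3, Finset.sum_congr rfl fun x _ => h2 x, Finset.sum_const,
    Finset.card_univ, nsmul_eq_mul] at h1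
  have h5 : (((Fintype.card F + 1 : ℕ)) : ℂ) = 0 := by
    push_cast
    linear_combination (Fintype.card F : ℂ) * h1 -
      ((Fintype.card F : ℂ) * (1 / (Fintype.card F : ℂ)) + 1) * mul_one_div_cancel hq0
  exact Nat.succ_ne_zero _ (Nat.cast_eq_zero.1 h5)

lemma tprod_sum_vec₂_diagonal (g : Matrix.GeneralLinearGroup (Fin 2) F) :
    ρ.tprod σ g (∑ x, vec₂ D E x x) = (D.μ * E.μ) g • ∑ x, vec₂ D E x x := by
  rw [map_sum, Finset.smul_sum]
  refine Fintype.sum_equiv (MulAction.toPerm g) _ _ fun x => ?_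
  rw [MulAction.toPerm_apply, tprod_vec₂]

lemma char_eq_of_tprod_apply (D : SteinbergFrame ρ) (E : SteinbergFrame σ)
    (hq : 3 ≤ Fintype.card F)
    {χ : Matrix.GeneralLinearGroup (Fin 2) F →* ℂ} {z : TensorProduct ℂ V W} (hz : z ≠ 0)
    (h : ∀ g, ρ.tprod σ g z = χ g • z) : χ = D.μ * E.μ := by
  have hf : ∀ g a b, χ g * coord₂ D E (g • a) (g • b) z = (D.μ * E.μ) g * coord₂ D E a b z :=
    fun g a b => by rw [← coord₂_tprod, h, map_smul, smul_eq_mul]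
  have h0 : coord₂ D E ∞ ((0 : F) : OnePoint F) z ≠ 0 := by
    intro h0
    have hoff : ∀ a b, a ≠ b → coord₂ D E a b z = 0 := fun a b hab => by
      obtain ⟨g, rfl, rfl⟩ := exists_smul_infty_zero hab
      have := hf g ∞ ((0 : F) : OnePoint F)
      rw [h0, mul_zero] at this
      exact (mul_eq_zero.1 this).resolve_left (char_ne_zero χ g)
    refine hz (eq_zero_of_coord₂ D E fun a b => ?_)
    by_cases hab : a = b
    · subst hab
      have := sum_coord₂_right D E a z
      rwa [Fintype.sum_eq_single a fun b hb => hoff a b hb.symm] at this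
    · exact hoff a b hab
  refine char_ext hq fun a d had => ?_
  have := hf (diag a d had) ∞ ((0 : F) : OnePoint F)
  rw [show diag a d had • (∞ : OnePoint F) = ∞ by simp [diag, mk_smul_infty],
    show diag a d had • ((0 : F) : OnePoint F) = ((0 : F) : OnePoint F) by
      simp [diag, mk_smul_coe, right_ne_zero_of_mul had]] at this
  exact mul_right_cancel₀ h0 this

end SteinbergFrame

end Tensor

section Hom

variable {G : Type} [Group G] {X Y : FDRep ℂ G}

/-- The morphism of representations given by an equivariant linear map. -/
def homOfEquivariant (f : X →ₗ[ℂ] Y) (hf : ∀ g x, f (X.ρ g x) = Y.ρ g (f x)) : X ⟶ Y :=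
  ⟨InducedCategory.homMk (ModuleCat.ofHom f), fun g => by
    ext x
    exact hf g x⟩

/-- The linear map underlying a morphism of representations. -/
def toLinear (f : X ⟶ Y) : X →ₗ[ℂ] Y := f.hom.hom.hom

@[simp] lemma toLinear_homOfEquivariant (f : X →ₗ[ℂ] Y)
    (hf : ∀ g x, f (X.ρ g x) = Y.ρ g (f x)) : toLinear (homOfEquivariant f hf) = f := rfl

@[simp] lemma toLinear_smul (c : ℂ) (f : X ⟶ Y) : toLinear (c • f) = c • toLinear f := rfl

@[simp] lemma toLinear_id : toLinear (𝟙 X) = 1 := rfl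

lemma toLinear_injective : Function.Injective (toLinear : (X ⟶ Y) → (X →ₗ[ℂ] Y)) := by
  intro f g h
  ext x
  exact LinearMap.congr_fun h x

lemma toLinear_ρ (f : X ⟶ Y) (g : G) (x : X) : toLinear f (X.ρ g x) = Y.ρ g (toLinear f x) :=
  LinearMap.congr_fun (congrArg (fun h => h.hom.hom) (f.comm g)) x

lemma isSchur_of_simple [Simple X] : IsSchur X.ρ := by
  intro T hT
  obtain ⟨c, hc⟩ := endomorphism_simple_eq_smul_id ℂ
    (homOfEquivariant T fun g x => LinearMap.congr_fun (hT g) x)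
  exact ⟨c, by simpa using (congrArg toLinear hc).symm⟩

lemma isSchur_of_finrank_eq_one (hX : finrank ℂ X = 1) : IsSchur X.ρ := by
  intro T _
  obtain ⟨v, hv, hspan⟩ := finrank_eq_one_iff'.1 hX
  obtain ⟨c, hc⟩ := hspan (T v)
  refine ⟨c, LinearMap.ext fun w => ?_⟩
  obtain ⟨d, rfl⟩ := hspan w
  simp [← hc, smul_smul, mul_comm]

variable [Finite G]

lemma finrank_hom_le_one (hX : IsSchur X.ρ)
    (hY : ∀ S T : Y →ₗ[ℂ] Y, (∀ g, S * Y.ρ g = Y.ρ g * S) → (∀ g, T * Y.ρ g = Y.ρ g * T) →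
      S * T = T * S) : finrank ℂ (X ⟶ Y) ≤ 1 := by
  cases nonempty_fintype G
  by_cases h0 : ∃ f : X ⟶ Y, f ≠ 0
  swap
  · push Not at h0
    exact finrank_le_one 0 fun f => ⟨0, by rw [h0 f, smul_zero]⟩
  obtain ⟨f, hf⟩ := h0
  obtain ⟨x, hx⟩ : ∃ x, toLinear f x ≠ 0 := by
    by_contra! h
    exact hf (toLinear_injective (LinearMap.ext h))
  obtain ⟨φ, hφ⟩ := not_forall.1 (mt (Module.forall_dual_apply_eq_zero_iff ℂ (toLinear f x)).1 hx)
  -- an equivariant map in the other direction, obtained by averaging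
  let R : Y →ₗ[ℂ] X := ∑ g, X.ρ g ∘ₗ φ.smulRight x ∘ₗ Y.ρ g⁻¹
  have hR : ∀ g y, R (Y.ρ g y) = X.ρ g (R y) := fun g y => by
    simp only [R, LinearMap.sum_apply, map_sum, LinearMap.comp_apply]
    refine Fintype.sum_equiv (Equiv.mulLeft g⁻¹) _ _ fun h => ?_
    rw [← Module.End.mul_apply (X.ρ g), ← Module.End.mul_apply (Y.ρ h⁻¹), ← map_mul, ← map_mul]
    simp
  have hRf : LinearMap.trace ℂ X (R ∘ₗ toLinear f) = Fintype.card G * φ (toLinear f x) := by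
    have hg : ∀ g, LinearMap.trace ℂ X ((X.ρ g ∘ₗ φ.smulRight x ∘ₗ Y.ρ g⁻¹) ∘ₗ toLinear f) =
        φ (toLinear f x) := fun g => by
      have e : (X.ρ g ∘ₗ φ.smulRight x ∘ₗ Y.ρ g⁻¹) ∘ₗ toLinear f =
          X.ρ g * ((φ ∘ₗ toLinear f).smulRight x * X.ρ g⁻¹) := by
        ext y
        simp [toLinear_ρ]
      rw [e, LinearMap.trace_mul_comm, mul_assoc, ← map_mul, inv_mul_cancel, map_one, mul_one,
        LinearMap.trace_smulRight, LinearMap.comp_apply]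
    have e : R ∘ₗ toLinear f =
        ∑ g, (X.ρ g ∘ₗ φ.smulRight x ∘ₗ Y.ρ g⁻¹) ∘ₗ toLinear f := by
      ext y
      simp [R]
    rw [e, map_sum, Finset.sum_congr rfl fun g _ => hg g, Finset.sum_const, Finset.card_univ,
      nsmul_eq_mul]
  have hEnd : ∀ h : X ⟶ Y, ∃ c : ℂ, R ∘ₗ toLinear h = c • 1 := fun h =>
    hX _ fun g => by
      ext y
      simp [toLinear_ρ, hR]
  obtain ⟨k, hk⟩ := hEnd f
  have hk0 : k ≠ 0 := by
    rintro rfl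
    rw [hk, zero_smul, map_zero] at hRf
    have hG : (Fintype.card G : ℂ) ≠ 0 := Nat.cast_ne_zero.2 Fintype.card_ne_zero
    exact mul_ne_zero hG hφ hRf.symm
  refine finrank_le_one f fun h => ?_
  obtain ⟨c, hc⟩ := hEnd h
  have hcomm := hY (toLinear f ∘ₗ R) (toLinear h ∘ₗ R)
    (fun g => by ext y; simp [toLinear_ρ, hR]) (fun g => by ext y; simp [toLinear_ρ, hR])
  refine ⟨k⁻¹ * c, toLinear_injective (LinearMap.ext fun y => ?_)⟩
  have h1 := LinearMap.congr_fun hcomm (toLinear f y)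
  have hk' : ∀ y, R (toLinear f y) = k • y := fun y => LinearMap.congr_fun hk y
  have hc' : ∀ y, R (toLinear h y) = c • y := fun y => LinearMap.congr_fun hc y
  simp only [Module.End.mul_apply, LinearMap.comp_apply, hk', hc', map_smul, smul_smul] at h1
  have h2 := congrArg ((k * k)⁻¹ • ·) h1
  simp only [smul_smul, inv_mul_cancel₀ (mul_ne_zero hk0 hk0), one_smul] at h2
  rw [← h2, toLinear_smul, LinearMap.smul_apply]
  congr 1
  field_simp

end Hom

section OneDimensional

variable {G : Type} [Group G]

lemma exists_char_of_finrank_eq_one {X : FDRep ℂ G} (hX : finrank ℂ X = 1) :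
    ∃ χ : G →* ℂ, ∀ g x, X.ρ g x = χ g • x := by
  refine ⟨LinearMap.det.comp X.ρ, fun g x => ?_⟩
  obtain ⟨v, hv, hspan⟩ := finrank_eq_one_iff'.1 hX
  obtain ⟨c, hc⟩ := hspan (X.ρ g v)
  have h : X.ρ g = c • 1 := LinearMap.ext fun w => by
    obtain ⟨d, rfl⟩ := hspan w
    simp [← hc, smul_smul, mul_comm]
  rw [MonoidHom.comp_apply, h, LinearMap.det_smul, hX]
  simp

lemma nonempty_iso_of_finrank_eq_one {X Y : FDRep ℂ G} (hX : finrank ℂ X = 1)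
    (hY : finrank ℂ Y = 1) {χ : G →* ℂ} (hX' : ∀ g x, X.ρ g x = χ g • x)
    (hY' : ∀ g y, Y.ρ g y = χ g • y) : Nonempty (X ≅ Y) := by
  let e : X ≃ₗ[ℂ] Y := LinearEquiv.ofFinrankEq X Y (hX.trans hY.symm)
  refine ⟨⟨homOfEquivariant e fun g x => ?_, homOfEquivariant e.symm fun g x => ?_, ?_, ?_⟩⟩
  · rw [hX', hY', map_smul]
  · rw [hX', hY', map_smul]
  · exact toLinear_injective (LinearMap.ext e.symm_apply_apply)
  · exact toLinear_injective (LinearMap.ext e.apply_symm_apply)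

/-- The one-dimensional representation attached to a linear character. -/
def charRep (χ : G →* ℂ) : FDRep ℂ G :=
  FDRep.of ((algebraMap ℂ (Module.End ℂ ℂ)).toMonoidHom.comp χ)

lemma charRep_ρ (χ : G →* ℂ) (g : G) (x : ℂ) : (charRep χ).ρ g x = χ g • x := rfl

lemma finrank_charRep (χ : G →* ℂ) : finrank ℂ (charRep χ) = 1 := finrank_self ℂ

end OneDimensional

end GLTwo

/-- For `q ≥ 3` a prime power, the tensor product of two irreducible complex
`q`-dimensional representations of `GL₂(q)` is multiplicity free, and it contains exactly
one isomorphism class of one-dimensional subrepresentations, occurring with multiplicity one. -/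
theorem tensor_q_q_multFree (q : ℕ) (hq : 3 ≤ q)
    (F : Type) [Field F] [Fintype F] (hF : Fintype.card F = q)
    (π₁ π₂ : FDRep ℂ (Matrix.GeneralLinearGroup (Fin 2) F)) [Simple π₁] [Simple π₂]
    (h₁ : finrank ℂ π₁ = q) (h₂ : finrank ℂ π₂ = q) :
    (∀ χ : FDRep ℂ (Matrix.GeneralLinearGroup (Fin 2) F), Simple χ →
        finrank ℂ (χ ⟶ π₁ ⊗ π₂) ≤ 1) ∧
      (∃ χ : FDRep ℂ (Matrix.GeneralLinearGroup (Fin 2) F), finrank ℂ χ = 1 ∧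
        finrank ℂ (χ ⟶ π₁ ⊗ π₂) = 1 ∧
        ∀ χ' : FDRep ℂ (Matrix.GeneralLinearGroup (Fin 2) F), finrank ℂ χ' = 1 →
          1 ≤ finrank ℂ (χ' ⟶ π₁ ⊗ π₂) → Nonempty (χ' ≅ χ)) := by
  classical
  subst hF
  obtain ⟨D⟩ := GLTwo.nonempty_steinbergFrame GLTwo.isSchur_of_simple hq h₁
  obtain ⟨E⟩ := GLTwo.nonempty_steinbergFrame GLTwo.isSchur_of_simple hq h₂
  have hle : ∀ χ : FDRep ℂ (Matrix.GeneralLinearGroup (Fin 2) F), GLTwo.IsSchur χ.ρ →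
      finrank ℂ (χ ⟶ π₁ ⊗ π₂) ≤ 1 := fun χ hχ =>
    GLTwo.finrank_hom_le_one hχ fun S T hS hT => D.commute_of_equivariant E hq hS hT
  refine ⟨fun χ _ => hle χ GLTwo.isSchur_of_simple, GLTwo.charRep (D.μ * E.μ),
    GLTwo.finrank_charRep _, le_antisymm (hle _ (GLTwo.isSchur_of_finrank_eq_one
      (GLTwo.finrank_charRep _))) ?_, fun χ hχ hpos => ?_⟩
  · let z : TensorProduct ℂ π₁ π₂ := ∑ x, D.vec₂ E x x
    let f : GLTwo.charRep (D.μ * E.μ) ⟶ π₁ ⊗ π₂ :=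
      GLTwo.homOfEquivariant (LinearMap.toSpanSingleton ℂ (TensorProduct ℂ π₁ π₂) z)
        fun g (c : ℂ) => by
          have h : Representation.tprod π₁.ρ π₂.ρ g z = (D.μ * E.μ) g • z :=
            D.tprod_sum_vec₂_diagonal E g
          change ((D.μ * E.μ) g • c) • z = Representation.tprod π₁.ρ π₂.ρ g (c • z)
          rw [map_smul, h, smul_smul, smul_eq_mul, mul_comm]
    refine finrank_pos_iff_exists_ne_zero.2 ⟨f, fun hf => D.sum_vec₂_diagonal_ne_zero E ?_⟩
    have h := LinearMap.congr_fun (congrArg GLTwo.toLinear hf) (1 : ℂ)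
    exact (one_smul ℂ z).symm.trans h
  · obtain ⟨f, hf⟩ := finrank_pos_iff_exists_ne_zero.1 hpos
    obtain ⟨x, hx⟩ : ∃ x, GLTwo.toLinear f x ≠ 0 := by
      by_contra! h
      exact hf (GLTwo.toLinear_injective (LinearMap.ext h))
    obtain ⟨ν, hν⟩ := GLTwo.exists_char_of_finrank_eq_one hχ
    have h : ν = D.μ * E.μ := D.char_eq_of_tprod_apply E hq hx fun g => by
      have := GLTwo.toLinear_ρ f g x
      rw [hν, map_smul] at this
      exact this.symm
    subst h
    exact GLTwo.nonempty_iso_of_finrank_eq_one hχ (GLTwo.finrank_charRep _) hν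
      (GLTwo.charRep_ρ _)
end
end

section
/- Let q ≥ 3 be a prime power and let π₁, π₂ be irreducible complex representations of GL₂(q), each of dimension q. Then the number of isomorphism classes of irreducible representations of GL₂(q) of dimension q that occur in the tensor product π₁ ⊗ π₂ equals 2 if q is odd and equals 1 if q is even. -/
open CategoryTheory Module MonoidalCategory

noncomputable section

/-- The setoid identifying isomorphic objects on the subtype of objects of a category
satisfying a predicate `P`. -/
def isoSetoid {C : Type*} [Category C] (P : C → Prop) : Setoid {X : C // P X} where
  r X Y := Nonempty (X.1 ≅ Y.1)
  iseqv := ⟨fun _ => ⟨Iso.refl _⟩, fun ⟨e⟩ => ⟨e.symm⟩, fun ⟨e⟩ ⟨f⟩ => ⟨e.trans f⟩⟩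

section

open Matrix

section LinearAlgebra

variable {V : Type*} [AddCommGroup V] [Module ℂ V] [FiniteDimensional ℂ V]

/-- The trace of an idempotent endomorphism is the dimension of its range. -/
theorem trace_eq_finrank_range_of_isIdempotentElem {E : Module.End ℂ V}
    (hE : IsIdempotentElem E) :
    LinearMap.trace ℂ V E = finrank ℂ (LinearMap.range E) := by
  have hp : LinearMap.IsProj (LinearMap.range E) E :=
    ⟨fun x => ⟨x, rfl⟩, by rintro _ ⟨y, rfl⟩; exact LinearMap.congr_fun hE y⟩
  exact hp.trace

theorem mul_eq_trace_smul_of_trace_eq_one {E A : Module.End ℂ V} (hE : IsIdempotentElem E)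
    (h1 : LinearMap.trace ℂ V E = 1) (hA : A * E = E * A) :
    A * E = LinearMap.trace ℂ V (A * E) • E := by
  have hr : finrank ℂ (LinearMap.range E) = 1 := by
    have := trace_eq_finrank_range_of_isIdempotentElem hE
    rw [h1] at this
    exact_mod_cast this.symm
  obtain ⟨⟨v, w, rfl⟩, -, hv⟩ := finrank_eq_one_iff'.1 hr
  obtain ⟨a, ha⟩ : ∃ a : ℂ, A (E w) = a • E w := by
    obtain ⟨c, hc⟩ := hv ⟨E (A w), _, rfl⟩
    refine ⟨c, ?_⟩
    rw [← Module.End.mul_apply, hA]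
    exact (congrArg Subtype.val hc).symm
  have key : A * E = a • E := by
    ext x
    obtain ⟨c, hc⟩ := hv ⟨E x, _, rfl⟩
    have hc' : c • E w = E x := congrArg Subtype.val hc
    rw [LinearMap.smul_apply, Module.End.mul_apply, ← hc', map_smul, ha, smul_comm]
  rw [key, map_smul, h1, smul_eq_mul, mul_one]

theorem eq_one_of_isIdempotentElem_of_trace {E : Module.End ℂ V} (hE : IsIdempotentElem E)
    (h : LinearMap.trace ℂ V E = finrank ℂ V) : E = 1 := by
  have hr : finrank ℂ (LinearMap.range E) = finrank ℂ V := by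
    have := trace_eq_finrank_range_of_isIdempotentElem hE
    rw [h] at this
    exact_mod_cast this.symm
  have ht := Submodule.eq_top_of_finrank_eq hr
  ext x
  obtain ⟨y, rfl⟩ : x ∈ LinearMap.range E := ht ▸ trivial
  exact LinearMap.congr_fun hE y

end LinearAlgebra

section CharacterInverse

open scoped ComplexOrder in
/-- For a representation of a finite group, the trace of `ρ g⁻¹` is the complex conjugate
of the trace of `ρ g`. -/
theorem Matrix.trace_map_inv_eq_conj {G n : Type*} [Group G] [Finite G] [Fintype n]
    [DecidableEq n] (M : G →* Matrix n n ℂ) (g : G) :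
    (M g⁻¹).trace = star (M g).trace := by
  have := Fintype.ofFinite G
  set H : Matrix n n ℂ := ∑ x, (M x)ᴴ * M x with hH
  have hinv : (M g)ᴴ * H * M g = H := by
    simp only [hH, Finset.mul_sum, Finset.sum_mul]
    refine Fintype.sum_equiv (Equiv.mulRight g) _ _ fun x => ?_
    simp [Matrix.conjTranspose_mul, Matrix.mul_assoc]
  have hpd : H.PosDef := by
    classical
    rw [hH, ← Finset.add_sum_erase _ _ (Finset.mem_univ (1 : G))]
    refine Matrix.PosDef.add_posSemidef ?_ (Matrix.posSemidef_sum _ fun x _ =>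
      Matrix.posSemidef_conjTranspose_mul_self _)
    simpa using Matrix.PosDef.one
  have hu : IsUnit H.det := (Matrix.isUnit_iff_isUnit_det _).1 hpd.isUnit
  have hg : M g * M g⁻¹ = 1 := by rw [← map_mul]; simp
  have h2 : M g⁻¹ = H⁻¹ * ((M g)ᴴ * H) := by
    have : H * M g⁻¹ = (M g)ᴴ * H := by
      conv_lhs => rw [← hinv]
      rw [Matrix.mul_assoc, hg, Matrix.mul_one]
    rw [← this, Matrix.nonsing_inv_mul_cancel_left _ _ hu]
  rw [h2, Matrix.trace_mul_comm, Matrix.mul_nonsing_inv_cancel_right _ _ hu,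
    Matrix.trace_conjTranspose]

theorem FDRep.character_inv_eq_conj {G : Type} [Group G] [Finite G] (V : FDRep ℂ G) (g : G) :
    V.character g⁻¹ = star (V.character g) := by
  let b := finBasis ℂ V
  have h := Matrix.trace_map_inv_eq_conj
    ((MonoidHomClass.toMonoidHom (LinearMap.toMatrixAlgEquiv b)).comp V.ρ) g
  have h2 : ∀ x, V.character x = (LinearMap.toMatrixAlgEquiv b (V.ρ x)).trace := fun x =>
    LinearMap.trace_eq_matrix_trace ℂ b _
  rw [h2, h2]
  exact h

end CharacterInverse

section Elements

variable {F : Type} [Field F]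

/-- The upper triangular element with diagonal entries `a`, `d` and upper right entry `x`. -/
def upperTri (a d : Fˣ) (x : F) : GL (Fin 2) F :=
  GeneralLinearGroup.mkOfDetNeZero !![(a : F), x; 0, (d : F)] (by simp)

@[simp] theorem coe_upperTri (a d : Fˣ) (x : F) :
    (upperTri a d x : Matrix (Fin 2) (Fin 2) F) = !![(a : F), x; 0, (d : F)] := rfl

theorem upperTri_mul (a d a' d' : Fˣ) (x x' : F) :
    upperTri a d x * upperTri a' d' x' = upperTri (a * a') (d * d') (a * x' + x * d') := by
  ext i j
  fin_cases i <;> fin_cases j <;> simp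

@[simp] theorem upperTri_one : upperTri (1 : Fˣ) 1 0 = 1 := by
  ext i j
  fin_cases i <;> fin_cases j <;> simp

@[simp] theorem det_upperTri (a d : Fˣ) (x : F) :
    GeneralLinearGroup.det (upperTri a d x) = a * d := by
  ext
  simp [GeneralLinearGroup.det]

/-- The Weyl element. -/
def weyl : GL (Fin 2) F := GeneralLinearGroup.mkOfDetNeZero !![0, 1; 1, 0] (by simp)

@[simp] theorem coe_weyl : ((weyl : GL (Fin 2) F) : Matrix (Fin 2) (Fin 2) F) = !![0, 1; 1, 0] :=
  rfl

theorem weyl_mul_weyl : (weyl : GL (Fin 2) F) * weyl = 1 := by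
  ext i j
  fin_cases i <;> fin_cases j <;> simp

theorem weyl_mul_upperTri_mul_weyl (a d : Fˣ) :
    weyl * upperTri a d 0 * weyl⁻¹ = upperTri d a 0 := by
  rw [mul_inv_eq_iff_eq_mul]
  ext i j
  fin_cases i <;> fin_cases j <;> simp

end Elements

open scoped Classical

section UnipotentProjector

variable {F : Type} [Field F] [Fintype F] {V : Type*} [AddCommGroup V] [Module ℂ V]

/-- The projector onto the `ψ`-isotypic part of the restriction of `ρ` to the upper
unipotent subgroup. -/
def unipotentProj (ρ : GL (Fin 2) F →* Module.End ℂ V) (ψ : AddChar F ℂ) : Module.End ℂ V :=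
  (Fintype.card F : ℂ)⁻¹ • ∑ x, ψ (-x) • ρ (upperTri 1 1 x)

variable (ρ : GL (Fin 2) F →* Module.End ℂ V)

theorem map_upperTri_mul_unipotentProj (ψ : AddChar F ℂ) (y : F) :
    ρ (upperTri 1 1 y) * unipotentProj ρ ψ = ψ y • unipotentProj ρ ψ := by
  rw [unipotentProj, mul_smul_comm, smul_comm (ψ y), Finset.mul_sum,
    Finset.smul_sum (r := ψ y)]
  congr 1
  refine Fintype.sum_equiv (Equiv.addLeft y) _ _ fun x => ?_
  rw [mul_smul_comm, ← map_mul, upperTri_mul, smul_smul]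
  simp [← AddChar.map_add_eq_mul, add_comm]

theorem isIdempotentElem_unipotentProj (ψ : AddChar F ℂ) :
    IsIdempotentElem (unipotentProj ρ ψ) := by
  have hq : (Fintype.card F : ℂ) ≠ 0 := by simp
  rw [IsIdempotentElem]
  nth_rewrite 1 [unipotentProj]
  simp only [smul_mul_assoc, Finset.sum_mul, map_upperTri_mul_unipotentProj, smul_smul,
    ← AddChar.map_add_eq_mul]
  simp [← Nat.cast_smul_eq_nsmul ℂ, smul_smul, hq]

theorem map_upperTri_diagonal_mul_unipotentProj (a d : Fˣ) :
    ρ (upperTri a d 0) * unipotentProj ρ 1 = unipotentProj ρ 1 * ρ (upperTri a d 0) := by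
  rw [unipotentProj, mul_smul_comm, smul_mul_assoc, Finset.mul_sum, Finset.sum_mul]
  congr 1
  refine Fintype.sum_equiv (Units.mulLeft (a * d⁻¹)) _ _ fun x => ?_
  simp only [AddChar.one_apply, one_smul, ← map_mul, upperTri_mul]
  simp [mul_comm, mul_left_comm]

variable [FiniteDimensional ℂ V]

omit [Fintype F] [FiniteDimensional ℂ V] in
theorem trace_map_conj (x g : GL (Fin 2) F) :
    LinearMap.trace ℂ V (ρ (x * g * x⁻¹)) = LinearMap.trace ℂ V (ρ g) := by
  rw [map_mul, LinearMap.trace_mul_comm, ← map_mul, inv_mul_cancel_left]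

omit [Fintype F] [FiniteDimensional ℂ V] in
theorem trace_map_unipotent {x : F} (hx : x ≠ 0) :
    LinearMap.trace ℂ V (ρ (upperTri 1 1 x)) = LinearMap.trace ℂ V (ρ (upperTri 1 1 1)) := by
  rw [← trace_map_conj ρ (upperTri (Units.mk0 x hx) 1 0) (upperTri 1 1 1)]
  congr 2
  rw [eq_mul_inv_iff_mul_eq]
  simp [upperTri_mul]

theorem trace_unipotentProj (ψ : AddChar F ℂ) :
    LinearMap.trace ℂ V (unipotentProj ρ ψ) = (Fintype.card F : ℂ)⁻¹ *
      (finrank ℂ V + (∑ x, ψ x - 1) * LinearMap.trace ℂ V (ρ (upperTri 1 1 1))) := by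
  rw [unipotentProj, map_smul, map_sum, smul_eq_mul,
    ← Finset.add_sum_erase _ _ (Finset.mem_univ 0)]
  congr 2
  · simp
  · have h : ∀ x ∈ Finset.univ.erase (0 : F),
        LinearMap.trace ℂ V (ψ (-x) • ρ (upperTri 1 1 x)) =
          ψ (-x) * LinearMap.trace ℂ V (ρ (upperTri 1 1 1)) := fun x hx => by
      rw [map_smul, trace_map_unipotent ρ (Finset.ne_of_mem_erase hx), smul_eq_mul]
    rw [Finset.sum_congr rfl h, ← Finset.sum_mul, Finset.sum_erase_eq_sub (Finset.mem_univ _)]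
    congr 2
    · exact Fintype.sum_equiv (Equiv.neg F) _ _ fun x => rfl
    · simp

/-- In a `q`-dimensional representation, the space of vectors fixed by the upper unipotent
subgroup has dimension `1` or `q`. -/
theorem trace_unipotentProj_eq_one_or (hq : 3 ≤ Fintype.card F)
    (hV : finrank ℂ V = Fintype.card F) :
    LinearMap.trace ℂ V (unipotentProj ρ 1) = 1 ∨
      LinearMap.trace ℂ V (unipotentProj ρ 1) = Fintype.card F := by
  obtain ⟨ψ, hψ⟩ : ∃ ψ : AddChar F ℂ, ψ ≠ 1 :=
    ⟨AddChar.FiniteField.primitiveChar_to_Complex F, by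
      simpa using (AddChar.FiniteField.primitiveChar_to_Complex_isPrimitive F) one_ne_zero⟩
  have h0 : (Fintype.card F : ℂ) ≠ 0 := by simp
  have e1 := trace_unipotentProj ρ 1
  have e2 := trace_unipotentProj ρ ψ
  rw [AddChar.sum_eq_zero_of_ne_one hψ] at e2
  rw [AddChar.sum_eq_card_of_eq_one rfl] at e1
  rw [trace_eq_finrank_range_of_isIdempotentElem (isIdempotentElem_unipotentProj ρ _), hV]
    at e1 e2
  rw [trace_eq_finrank_range_of_isIdempotentElem (isIdempotentElem_unipotentProj ρ _)]
  generalize finrank ℂ (LinearMap.range (unipotentProj ρ 1)) = r at *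
  generalize finrank ℂ (LinearMap.range (unipotentProj ρ ψ)) = m at *
  generalize Fintype.card F = q at *
  have key : r + (q - 1) * m = q := by
    have : ((r + (q - 1 : ℕ) * m : ℕ) : ℂ) = q := by
      push_cast [Nat.cast_sub (show 1 ≤ q by lia)]
      rw [e1, e2]
      field_simp
      ring
    exact_mod_cast this
  obtain ⟨k, rfl⟩ : ∃ k, q = k + 3 := ⟨q - 3, by lia⟩
  rcases m with _ | _ | m
  · right; simp at key; simp [key]
  · left
    have : r = 1 := by simp at key; lia
    simp [this]
  · exfalso
    rw [show k + 3 - 1 = k + 2 from rfl] at key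
    nlinarith

end UnipotentProjector

section HighestWeight

theorem FDRep.exists_eq_smul_one_of_commute {G : Type} [Group G] (V : FDRep ℂ G) [Simple V]
    (f : Module.End ℂ V) (hf : ∀ g, f * V.ρ g = V.ρ g * f) : ∃ c : ℂ, f = c • 1 := by
  let φ : V ⟶ V := ⟨InducedCategory.homMk (ModuleCat.ofHom f), fun g => by
    ext1
    exact hf g⟩
  obtain ⟨c, hc⟩ := CategoryTheory.endomorphism_simple_eq_smul_id ℂ φ
  refine ⟨c, ?_⟩
  have : φ.hom.hom.hom = f := rfl
  rw [← this, ← hc]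
  rfl

variable {F : Type} [Field F]

theorem exists_map_eq_map_upperTri {M : Type*} [Monoid M] (ρ : GL (Fin 2) F →* M)
    (h : ∀ x, ρ (upperTri 1 1 x) = 1) (g : GL (Fin 2) F) :
    ∃ a d, ρ g = ρ (upperTri a d 0) := by
  have hupper : ∀ a d x, ρ (upperTri a d x) = ρ (upperTri a d 0) := fun a d x => by
    have : upperTri a d x = upperTri a d 0 * upperTri 1 1 ((a : F)⁻¹ * x) := by
      simp [upperTri_mul]
    rw [this, map_mul, h, mul_one]
  have hlower : ∀ x, ρ (weyl * upperTri 1 1 x * weyl) = 1 := fun x => by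
    rw [map_mul, map_mul, h, mul_one, ← map_mul, weyl_mul_weyl, map_one]
  have hweyl : ρ weyl = ρ (upperTri (-1) 1 0) := by
    have : (weyl : GL (Fin 2) F) * upperTri (-1) 1 0 =
        upperTri 1 1 1 * (weyl * upperTri 1 1 (-1) * weyl) * upperTri 1 1 1 := by
      ext i j
      fin_cases i <;> fin_cases j <;> simp
    have h2 : ρ weyl * ρ (upperTri (-1) 1 0) = 1 := by
      rw [← map_mul, this, map_mul, map_mul, h, hlower, mul_one, mul_one]
    calc ρ weyl = ρ weyl * (ρ (upperTri (-1) 1 0) * ρ (upperTri (-1) 1 0)) := by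
          rw [← map_mul, upperTri_mul]; simp
      _ = _ := by rw [← mul_assoc, h2, one_mul]
  by_cases hc : g 1 0 = 0
  · have hdet := g.det_ne_zero
    rw [det_fin_two, hc, mul_zero, sub_zero] at hdet
    refine ⟨Units.mk0 _ (left_ne_zero_of_mul hdet), Units.mk0 _ (right_ne_zero_of_mul hdet), ?_⟩
    rw [← hupper _ _ (g 0 1)]
    congr 1
    ext i j
    fin_cases i <;> fin_cases j <;> simp [hc]
  · have hdet := g.det_ne_zero
    rw [det_fin_two] at hdet
    have he : g 0 1 - g 0 0 / g 1 0 * g 1 1 ≠ 0 := by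
      intro h0
      apply hdet
      field_simp at h0
      linear_combination -h0
    have : g = upperTri 1 1 (g 0 0 / g 1 0) *
        (weyl * upperTri (Units.mk0 _ hc) (Units.mk0 _ he) (g 1 1)) := by
      ext i j
      fin_cases i <;> fin_cases j <;> simp [hc]
    refine ⟨-1 * Units.mk0 _ hc, 1 * Units.mk0 _ he, ?_⟩
    refine (congrArg ρ this).trans ?_
    rw [map_mul, map_mul, h, one_mul, hweyl, hupper _ _ (g 1 1), ← map_mul, upperTri_mul]
    simp

variable [Fintype F]

theorem trace_unipotentProj_eq_one (hq : 3 ≤ Fintype.card F)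
    (V : FDRep ℂ (GL (Fin 2) F)) [Simple V] (hV : finrank ℂ V = Fintype.card F) :
    LinearMap.trace ℂ V (unipotentProj V.ρ 1) = 1 := by
  refine (trace_unipotentProj_eq_one_or V.ρ hq hV).resolve_right fun h => ?_
  have hE := eq_one_of_isIdempotentElem_of_trace (isIdempotentElem_unipotentProj V.ρ 1)
    (by rw [h, hV])
  have hu : ∀ x, V.ρ (upperTri 1 1 x) = 1 := fun x => by
    have := map_upperTri_mul_unipotentProj V.ρ 1 x
    rw [hE] at this
    simpa using this
  have hcomm : ∀ g h, V.ρ g * V.ρ h = V.ρ h * V.ρ g := fun g h => by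
    obtain ⟨a, d, hg⟩ := exists_map_eq_map_upperTri V.ρ hu g
    obtain ⟨a', d', hh⟩ := exists_map_eq_map_upperTri V.ρ hu h
    rw [hg, hh, ← map_mul, ← map_mul, upperTri_mul, upperTri_mul, mul_comm a, mul_comm d]
    simp
  have hnorm := (FDRep.simple_iff_char_is_norm_one V).1 inferInstance
  have hval : ∀ g, V.character g * V.character g⁻¹ = (Fintype.card F : ℂ) ^ 2 := fun g => by
    obtain ⟨c, hc⟩ := V.exists_eq_smul_one_of_commute (V.ρ g) fun h => hcomm g h
    have h1 : V.character g = c * Fintype.card F := by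
      rw [FDRep.character, hc, map_smul, LinearMap.trace_one, hV, smul_eq_mul]
    have h2 : c * V.character g⁻¹ = Fintype.card F := by
      rw [FDRep.character, ← smul_eq_mul, ← map_smul, ← one_mul (V.ρ g⁻¹), ← smul_mul_assoc,
        ← hc, ← map_mul, mul_inv_cancel, map_one, LinearMap.trace_one, hV]
    rw [h1, mul_right_comm, h2, sq]
  simp only [hval, Finset.sum_const, Finset.card_univ, nsmul_eq_mul] at hnorm
  rw [← Fintype.card_eq_nat_card] at hnorm
  have : Fintype.card (GL (Fin 2) F) * Fintype.card F ^ 2 = Fintype.card (GL (Fin 2) F) := by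
    exact_mod_cast hnorm
  have h3 : Fintype.card F ^ 2 = 1 := by
    simpa using this
  nlinarith

omit [Fintype F] in
theorem trace_map_upperTri_of_ne {V : Type*} [AddCommGroup V] [Module ℂ V]
    (ρ : GL (Fin 2) F →* Module.End ℂ V) {a d : Fˣ} (h : a ≠ d) (x : F) :
    LinearMap.trace ℂ V (ρ (upperTri a d x)) = LinearMap.trace ℂ V (ρ (upperTri a d 0)) := by
  have h' : (d : F) - a ≠ 0 := sub_ne_zero.2 fun e => h (Units.ext e.symm)
  rw [← trace_map_conj ρ (upperTri 1 1 (x / (d - a))) (upperTri a d 0)]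
  congr 2
  rw [eq_mul_inv_iff_mul_eq, upperTri_mul, upperTri_mul]
  congr 1
  · simp
  · simp
  · simp; field_simp; ring

theorem sum_trace_map_upperTri {V : Type*} [AddCommGroup V] [Module ℂ V]
    (ρ : GL (Fin 2) F →* Module.End ℂ V) (a d : Fˣ) :
    ∑ x, LinearMap.trace ℂ V (ρ (upperTri a d x)) =
      Fintype.card F * LinearMap.trace ℂ V (ρ (upperTri a d 0) * unipotentProj ρ 1) := by
  have hq : (Fintype.card F : ℂ) ≠ 0 := by simp
  rw [unipotentProj, mul_smul_comm, map_smul, smul_eq_mul, mul_inv_cancel_left₀ hq,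
    Finset.mul_sum, map_sum]
  refine Fintype.sum_equiv (Units.mulLeft a⁻¹) _ _ fun x => ?_
  rw [AddChar.one_apply, one_smul, ← map_mul, upperTri_mul]
  simp

/-- The diagonal torus acts through a character of the determinant on the line fixed by the
upper unipotent subgroup in a `q`-dimensional irreducible representation. -/
theorem exists_monoidHom_trace_upperTri (hq : 3 ≤ Fintype.card F)
    (V : FDRep ℂ (GL (Fin 2) F)) [Simple V] (hV : finrank ℂ V = Fintype.card F) :
    ∃ μ : Fˣ →* ℂˣ,
      (∀ a d, ∑ x, V.character (upperTri a d x) = Fintype.card F * (μ (a * d) : ℂ)) ∧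
      ∀ a, a ≠ 1 → V.character (upperTri a 1 0) = μ a := by
  set E := unipotentProj V.ρ 1 with hEdef
  have hE1 : LinearMap.trace ℂ V E = 1 := trace_unipotentProj_eq_one hq V hV
  have hE : IsIdempotentElem E := isIdempotentElem_unipotentProj V.ρ 1
  let w : Fˣ → Fˣ → ℂ := fun a d => LinearMap.trace ℂ V (V.ρ (upperTri a d 0) * E)
  have hw : ∀ a d, V.ρ (upperTri a d 0) * E = w a d • E := fun a d =>
    mul_eq_trace_smul_of_trace_eq_one hE hE1 (map_upperTri_diagonal_mul_unipotentProj V.ρ a d)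
  have hmul : ∀ a d a' d', w (a * a') (d * d') = w a d * w a' d' := fun a d a' d' => by
    have : upperTri (a * a') (d * d') 0 = upperTri a d 0 * upperTri a' d' 0 := by
      simp [upperTri_mul]
    change LinearMap.trace ℂ V (V.ρ (upperTri _ _ 0) * E) = _
    rw [this, map_mul V.ρ, mul_assoc, hw, mul_smul_comm, hw, map_smul, map_smul, hE1]
    simp [mul_comm]
  have hone : w 1 1 = 1 := by
    simp [w, hE1]
  have hreg : ∀ a d, a ≠ d → V.character (upperTri a d 0) = w a d := fun a d h => by
    have h0 : (Fintype.card F : ℂ) ≠ 0 := by simp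
    have := sum_trace_map_upperTri V.ρ a d
    simp only [trace_map_upperTri_of_ne V.ρ h, Finset.sum_const, Finset.card_univ,
      nsmul_eq_mul] at this
    exact mul_left_cancel₀ h0 this
  have hsymm : ∀ a, w 1 a = w a 1 := fun a => by
    by_cases ha : a = 1
    · rw [ha]
    · rw [← hreg _ _ ha, ← hreg _ _ (Ne.symm ha), ← weyl_mul_upperTri_mul_weyl, FDRep.char_conj]
  let μ₀ : Fˣ →* ℂ :=
    { toFun a := w a 1
      map_one' := hone
      map_mul' a b := by simpa using hmul a 1 b 1 }
  refine ⟨μ₀.toHomUnits, fun a d => ?_, fun a ha => hreg a 1 ha⟩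
  refine (sum_trace_map_upperTri V.ρ a d).trans ?_
  congr 1
  change w a d = w (a * d) 1
  rw [← one_mul (1 : Fˣ), hmul a 1 d 1, ← hsymm d, ← hmul, mul_one, one_mul]

end HighestWeight

section ProjectiveLine

variable {F : Type} [Field F]

theorem exists_smul_infty_eq (x : OnePoint F) :
    ∃ g : GL (Fin 2) F, g • (OnePoint.infty : OnePoint F) = x := by
  cases x with
  | infty => exact ⟨1, one_smul _ _⟩
  | coe y =>
    refine ⟨upperTri 1 1 y * weyl, ?_⟩
    simp [OnePoint.smul_infty_eq_ite]

/-- An element of `GL₂(F)` fixing three points of the projective line is scalar. -/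
theorem eq_upperTri_of_two_lt_card [Fintype F] {g : GL (Fin 2) F}
    (hg : 2 < (Finset.univ.filter fun x : OnePoint F => g • x = x).card) :
    ∃ a, g = upperTri a a 0 := by
  have hroots : ∀ y : F, g • (y : OnePoint F) = y →
      g 1 0 * y ^ 2 + (g 1 1 - g 0 0) * y - g 0 1 = 0 := fun y hy => by
    rw [← GeneralLinearGroup.fixpointPolynomial_aeval_eq_zero_iff] at hy
    simpa [GeneralLinearGroup.fixpointPolynomial] using hy
  have hscal : g 1 0 = 0 → g 0 1 = 0 → g 0 0 = g 1 1 → ∃ a, g = upperTri a a 0 := by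
    intro h1 h2 h3
    have hdet := g.det_ne_zero
    rw [det_fin_two, h1, mul_zero, sub_zero] at hdet
    refine ⟨Units.mk0 _ (left_ne_zero_of_mul hdet), ?_⟩
    ext i j
    fin_cases i <;> fin_cases j <;> simp [h1, h2, h3]
  have hinf : g • (OnePoint.infty : OnePoint F) = OnePoint.infty → g 1 0 = 0 :=
    OnePoint.smul_infty_eq_self_iff.1
  obtain ⟨x, y, z, hx, hy, hz, hxy, hxz, hyz⟩ := Finset.two_lt_card_iff.1 hg
  simp only [Finset.mem_filter, Finset.mem_univ, true_and] at hx hy hz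
  have htwo : ∀ y z : F, y ≠ z → g 1 0 = 0 → g • (y : OnePoint F) = y →
      g • (z : OnePoint F) = z → ∃ a, g = upperTri a a 0 := fun y z hyz h0 hy hz => by
    have e1 := hroots y hy
    have e2 := hroots z hz
    rw [h0] at e1 e2
    have hmul : (g 1 1 - g 0 0) * (y - z) = 0 := by linear_combination e1 - e2
    have h3 : g 1 1 - g 0 0 = 0 := (mul_eq_zero.1 hmul).resolve_right (sub_ne_zero.2 hyz)
    refine hscal h0 ?_ (sub_eq_zero.1 h3).symm
    rw [h3] at e1
    linear_combination -e1
  cases x with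
  | infty =>
    cases y with
    | infty => exact absurd rfl hxy
    | coe y =>
      cases z with
      | infty => exact absurd rfl hxz
      | coe z => exact htwo y z (by simpa using hyz) (hinf hx) hy hz
  | coe x =>
    cases y with
    | infty =>
      cases z with
      | infty => exact absurd rfl hyz
      | coe z => exact htwo x z (by simpa using hxz) (hinf hy) hx hz
    | coe y =>
      cases z with
      | infty => exact htwo x y (by simpa using hxy) (hinf hz) hx hy
      | coe z =>
        have e1 := hroots x hx
        have e2 := hroots y hy
        have e3 := hroots z hz
        have hxy' : x - y ≠ 0 := sub_ne_zero.2 (by simpa using hxy)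
        have hxz' : x - z ≠ 0 := sub_ne_zero.2 (by simpa using hxz)
        have hyz' : y - z ≠ 0 := sub_ne_zero.2 (by simpa using hyz)
        refine htwo x y (by simpa using hxy) ?_ hx hy
        have f1 := (mul_eq_zero.1 (show (x - y) * (g 1 0 * (x + y) + (g 1 1 - g 0 0)) = 0 by
          linear_combination e1 - e2)).resolve_left hxy'
        have f2 := (mul_eq_zero.1 (show (x - z) * (g 1 0 * (x + z) + (g 1 1 - g 0 0)) = 0 by
          linear_combination e1 - e3)).resolve_left hxz'
        exact (mul_eq_zero.1 (show g 1 0 * (y - z) = 0 by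
          linear_combination f1 - f2)).resolve_right hyz'

variable [Fintype F]

theorem card_generalLinearGroup_fin_two :
    (Nat.card (GL (Fin 2) F) : ℂ) =
      ((Fintype.card F : ℂ) + 1) * (Fintype.card F * (Fintype.card F - 1) ^ 2) := by
  have h1 : 1 ≤ Fintype.card F := Fintype.card_pos
  rw [card_GL_field, Fin.prod_univ_two]
  simp only [Fin.val_zero, Fin.val_one, pow_zero, pow_one]
  rw [Nat.cast_mul, Nat.cast_sub (Nat.one_le_pow _ _ h1),
    Nat.cast_sub (Nat.le_self_pow (by simp) _)]
  push_cast
  ring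

/-- The number of fixed points of `g` on the projective line. -/
def fixCount (g : GL (Fin 2) F) : ℂ :=
  (Finset.univ.filter fun x : OnePoint F => g • x = x).card

theorem fixCount_conj (h g : GL (Fin 2) F) : fixCount (h * g * h⁻¹) = fixCount g := by
  unfold fixCount
  congr 1
  refine (Finset.card_bij (fun x _ => h • x) ?_ ?_ ?_).symm
  · intro x hx
    simp only [Finset.mem_filter, Finset.mem_univ, true_and] at hx ⊢
    rw [mul_smul, mul_smul, inv_smul_smul, hx]
  · intro x _ y _ hxy
    exact smul_left_cancel h hxy
  · intro y hy
    simp only [Finset.mem_filter, Finset.mem_univ, true_and] at hy ⊢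
    refine ⟨h⁻¹ • y, ?_, smul_inv_smul _ _⟩
    rw [mul_smul, mul_smul] at hy
    nth_rewrite 2 [← hy]
    rw [inv_smul_smul]

theorem sum_filter_smul_infty_eq (f : GL (Fin 2) F → ℂ) :
    ∑ g with g • (OnePoint.infty : OnePoint F) = OnePoint.infty, f g =
      ∑ a, ∑ d, ∑ x, f (upperTri a d x) := by
  simp only [← Fintype.sum_prod_type']
  symm
  refine Finset.sum_bij (fun p _ => upperTri p.1 p.2.1 p.2.2) ?_ ?_ ?_ ?_
  · intro p _
    simp [OnePoint.smul_infty_eq_self_iff]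
  · rintro ⟨a, d, x⟩ _ ⟨a', d', x'⟩ _ h
    have h' := congrArg (fun g : GL (Fin 2) F => (g : Matrix (Fin 2) (Fin 2) F)) h
    have h00 := congrFun (congrFun h' 0) 0
    have h01 := congrFun (congrFun h' 0) 1
    have h11 := congrFun (congrFun h' 1) 1
    simp at h00 h01 h11
    simp [Units.ext h00, h01, Units.ext h11]
  · intro g hg
    have hc : g 1 0 = 0 := by
      simpa [OnePoint.smul_infty_eq_self_iff] using hg
    have hdet := g.det_ne_zero
    rw [det_fin_two, hc, mul_zero, sub_zero] at hdet
    refine ⟨(Units.mk0 _ (left_ne_zero_of_mul hdet), Units.mk0 _ (right_ne_zero_of_mul hdet),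
      g 0 1), Finset.mem_univ _, ?_⟩
    ext i j
    fin_cases i <;> fin_cases j <;> simp [hc]
  · intro p _
    rfl

/-- Frobenius reciprocity for the permutation character of the projective line. -/
theorem sum_mul_fixCount (f : GL (Fin 2) F → ℂ) (hf : ∀ h g, f (h * g * h⁻¹) = f g) :
    ∑ g, f g * fixCount g =
      (Fintype.card F + 1) * ∑ a, ∑ d, ∑ x, f (upperTri a d x) := by
  have h1 : ∀ g, f g * fixCount g = ∑ x : OnePoint F, if g • x = x then f g else 0 := fun g => by
    rw [fixCount, ← Finset.sum_filter, Finset.sum_const, nsmul_eq_mul, mul_comm]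
  simp only [h1]
  rw [Finset.sum_comm, ← sum_filter_smul_infty_eq, Finset.sum_filter]
  have h2 : ∀ x : OnePoint F, (∑ g : GL (Fin 2) F, if g • x = x then f g else 0) =
      ∑ g : GL (Fin 2) F, if g • (OnePoint.infty : OnePoint F) = OnePoint.infty
        then f g else 0 := fun x => by
    obtain ⟨h, rfl⟩ := exists_smul_infty_eq x
    refine (Fintype.sum_equiv (MulAut.conj h).toEquiv _ _ fun g => ?_).symm
    have : (h * g * h⁻¹) • h • (OnePoint.infty : OnePoint F) = h • OnePoint.infty ↔
        g • (OnePoint.infty : OnePoint F) = OnePoint.infty := by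
      rw [mul_smul, mul_smul, inv_smul_smul]
      exact (MulAction.injective h).eq_iff
    simp only [MulEquiv.toEquiv_eq_coe, MulEquiv.coe_toEquiv, MulAut.conj_apply, this, hf]
  simp only [h2, Finset.sum_const, nsmul_eq_mul, Finset.card_univ]
  congr 1
  have : Fintype.card (OnePoint F) = Fintype.card F + 1 := Fintype.card_option
  rw [this]
  push_cast
  rfl

theorem sum_fixCount : ∑ g : GL (Fin 2) F, fixCount g = Nat.card (GL (Fin 2) F) := by
  have := sum_mul_fixCount (F := F) (fun _ => 1) fun _ _ => rfl
  simp only [one_mul] at this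
  rw [this, card_generalLinearGroup_fin_two]
  have h1 : 1 ≤ Fintype.card F := Fintype.card_pos
  simp [Fintype.card_units, Nat.cast_sub h1]
  left
  ring

theorem sum_fixCount_upperTri :
    ∑ a : Fˣ, ∑ d : Fˣ, ∑ x, fixCount (upperTri a d x) =
      2 * (Fintype.card F * ((Fintype.card F : ℂ) - 1) ^ 2) := by
  have h1 : ∀ g : GL (Fin 2) F, fixCount g =
      (if g • (OnePoint.infty : OnePoint F) = OnePoint.infty then 1 else 0) +
        ∑ y : F, if g • (y : OnePoint F) = y then (1 : ℂ) else 0 := fun g => by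
    rw [fixCount, Finset.natCast_card_filter]
    exact Fintype.sum_option _
  have h2 : ∀ a d : Fˣ, ∑ x, fixCount (upperTri a d x) = 2 * Fintype.card F := fun a d => by
    simp only [h1, Finset.sum_add_distrib]
    rw [Finset.sum_comm]
    have h3 : ∀ y x : F, (upperTri a d x • (y : OnePoint F) = y ↔ x = d * y - a * y) :=
      fun y x => by
        rw [← GeneralLinearGroup.fixpointPolynomial_aeval_eq_zero_iff]
        simp [GeneralLinearGroup.fixpointPolynomial]
        constructor
        · intro h; linear_combination -h
        · intro h; linear_combination -h
    simp [h3, OnePoint.smul_infty_eq_self_iff]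
    ring
  have h1 : 1 ≤ Fintype.card F := Fintype.card_pos
  simp [h2, Fintype.card_units, Nat.cast_sub h1]
  ring

theorem sum_fixCount_mul_fixCount :
    ∑ g : GL (Fin 2) F, fixCount g * fixCount g = 2 * Nat.card (GL (Fin 2) F) := by
  rw [sum_mul_fixCount _ fixCount_conj, sum_fixCount_upperTri, card_generalLinearGroup_fin_two]
  ring

theorem fixCount_upperTri_self (a : Fˣ) : fixCount (upperTri a a 0) = Fintype.card F + 1 := by
  have : ∀ x : OnePoint F, upperTri a a 0 • x = x := fun x => by
    cases x with
    | infty => simp [OnePoint.smul_infty_eq_ite]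
    | coe y => simp [OnePoint.smul_some_eq_ite]
  have h2 : Fintype.card (OnePoint F) = Fintype.card F + 1 := Fintype.card_option
  simp [fixCount, this, h2]

theorem fixCount_sub_one_pow_three (g : GL (Fin 2) F) :
    (fixCount g - 1) ^ 3 = (fixCount g - 1) +
      if g ∈ Set.range (fun a : Fˣ => upperTri a a 0) then
        ((Fintype.card F : ℂ) ^ 3 - Fintype.card F) else 0 := by
  split_ifs with h
  · obtain ⟨a, rfl⟩ := h
    rw [fixCount_upperTri_self]
    ring
  · have : (Finset.univ.filter fun x : OnePoint F => g • x = x).card ≤ 2 := by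
      by_contra! hlt
      obtain ⟨a, ha⟩ := eq_upperTri_of_two_lt_card hlt
      exact h ⟨a, ha.symm⟩
    rw [fixCount]
    generalize (Finset.univ.filter fun x : OnePoint F => g • x = x).card = n at *
    interval_cases n <;> norm_num

end ProjectiveLine

section Steinberg

/-- The one-dimensional representation attached to a linear character. -/
def linearRep {G : Type} [Group G] (χ : G →* ℂˣ) : FDRep ℂ G :=
  FDRep.of ((Algebra.lmul ℂ ℂ).toMonoidHom.comp ((Units.coeHom ℂ).comp χ))

@[simp] theorem character_linearRep {G : Type} [Group G] (χ : G →* ℂˣ) (g : G) :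
    (linearRep χ).character g = χ g := by
  have : LinearMap.trace ℂ ℂ (Algebra.lmul ℂ ℂ (χ g : ℂ)) = χ g := by
    have h : Algebra.lmul ℂ ℂ (χ g : ℂ) = (χ g : ℂ) • LinearMap.id := rfl
    rw [h, map_smul, LinearMap.trace_id, finrank_self, Nat.cast_one, smul_eq_mul, mul_one]
  exact this

theorem simple_of_character_eq_mul {G : Type} [Group G] [Finite G] (χ : G →* ℂˣ)
    (V W : FDRep ℂ G) [Simple V] (h : ∀ g, W.character g = V.character g * χ g) :
    Simple W := by
  have := Fintype.ofFinite G
  rw [FDRep.simple_iff_char_is_norm_one, ← (FDRep.simple_iff_char_is_norm_one V).1 inferInstance]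
  refine Finset.sum_congr rfl fun g _ => ?_
  rw [h, h, map_inv, mul_mul_mul_comm, Units.mul_inv, mul_one]

theorem simple_linearRep {G : Type} [Group G] [Finite G] (χ : G →* ℂˣ) :
    Simple (linearRep χ) := by
  have := Fintype.ofFinite G
  rw [FDRep.simple_iff_char_is_norm_one]
  simp

theorem FDRep.finrank_eq_of_character_eq {G : Type} [Group G] {V W : FDRep ℂ G}
    (h : V.character = W.character) : finrank ℂ V = finrank ℂ W := by
  have := congrFun h 1
  rw [FDRep.char_one, FDRep.char_one] at this
  exact_mod_cast this

theorem FDRep.nonempty_iso_of_character_eq {G : Type} [Group G] [Finite G] {V W : FDRep ℂ G}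
    [Simple V] [Simple W] (h : V.character = W.character) : Nonempty (V ≅ W) := by
  have := Fintype.ofFinite G
  have := invertibleOfNonzero (NeZero.ne (Nat.card G : ℂ))
  by_contra hn
  have h1 := FDRep.char_orthonormal V W
  have h2 := FDRep.char_orthonormal V V
  rw [if_neg hn, ← h] at h1
  rw [if_pos ⟨Iso.refl V⟩, h1] at h2
  exact zero_ne_one h2

/-- A simple representation of dimension at least two is orthogonal to linear characters. -/
theorem sum_character_mul_linear_eq_zero {G : Type} [Group G] [Fintype G] (V : FDRep ℂ G)
    [Simple V] (hV : finrank ℂ V ≠ 1) (χ : G →* ℂˣ) :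
    ∑ g, V.character g * χ g = 0 := by
  have := invertibleOfNonzero (NeZero.ne (Nat.card G : ℂ))
  have := simple_linearRep χ⁻¹
  have h := FDRep.char_orthonormal V (linearRep χ⁻¹)
  rw [if_neg] at h
  · simpa using h
  · rintro ⟨e⟩
    apply hV
    rw [FDRep.finrank_eq_of_character_eq (FDRep.char_iso e)]
    exact finrank_self ℂ

variable {F : Type} [Field F] [Fintype F]

theorem character_eq_fixCount_sub_one (V : FDRep ℂ (GL (Fin 2) F)) [Simple V]
    (hV : finrank ℂ V ≠ 1)
    (h : ∑ a, ∑ d, ∑ x, V.character (upperTri a d x) =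
      Fintype.card F * ((Fintype.card F : ℂ) - 1) ^ 2) (g : GL (Fin 2) F) :
    V.character g = fixCount g - 1 := by
  have h1 : ∑ g, V.character g = 0 := by
    simpa using sum_character_mul_linear_eq_zero V hV 1
  have h2 : ∑ g, V.character g * fixCount g = Nat.card (GL (Fin 2) F) := by
    rw [sum_mul_fixCount _ fun h g => FDRep.char_conj V g h, h, card_generalLinearGroup_fin_two]
  have h3 : ∑ g, V.character g * star (V.character g) = Nat.card (GL (Fin 2) F) := by
    rw [← (FDRep.simple_iff_char_is_norm_one V).1 inferInstance]
    simp only [FDRep.character_inv_eq_conj]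
  have hstar : ∀ g : GL (Fin 2) F, star (fixCount g) = fixCount g := fun g => by
    simp [fixCount]
  have h4 : ∑ g, star (V.character g) = 0 := by
    rw [← star_sum, h1, star_zero]
  have h5 : ∑ g, star (V.character g) * fixCount g = Nat.card (GL (Fin 2) F) := by
    have := congrArg star h2
    rw [star_sum] at this
    simpa only [star_mul', hstar, star_natCast] using this
  have h6 : ∑ g, (V.character g - (fixCount g - 1)) * star (V.character g - (fixCount g - 1)) =
      0 := by
    have : ∀ g, (V.character g - (fixCount g - 1)) * star (V.character g - (fixCount g - 1)) =
        V.character g * star (V.character g) - V.character g * fixCount g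
          - star (V.character g) * fixCount g + V.character g + star (V.character g)
          + fixCount g * fixCount g - fixCount g - fixCount g + 1 := fun g => by
      rw [star_sub, star_sub, hstar, star_one]
      ring
    simp only [this, Finset.sum_add_distrib, Finset.sum_sub_distrib, h1, h2, h3, h4, h5,
      sum_fixCount, sum_fixCount_mul_fixCount]
    simp
    ring
  have h7 : ∑ g, Complex.normSq (V.character g - (fixCount g - 1)) = 0 := by
    have : ((∑ g, Complex.normSq (V.character g - (fixCount g - 1)) : ℝ) : ℂ) = 0 := by
      push_cast
      simpa only [Complex.mul_conj, Complex.star_def] using h6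
    exact_mod_cast this
  have h8 := (Finset.sum_eq_zero_iff_of_nonneg fun g _ => Complex.normSq_nonneg _).1 h7 g
    (Finset.mem_univ g)
  exact sub_eq_zero.1 (Complex.normSq_eq_zero.1 h8)

/-- Every irreducible representation of `GL₂(q)` of dimension `q` has the character of the twist
of the Steinberg representation by a character of the determinant. -/
theorem exists_character_eq_fixCount_sub_one_mul (hq : 3 ≤ Fintype.card F)
    (V : FDRep ℂ (GL (Fin 2) F)) [Simple V] (hV : finrank ℂ V = Fintype.card F) :
    ∃ μ : Fˣ →* ℂˣ, (∀ g, V.character g = (fixCount g - 1) * μ (GeneralLinearGroup.det g)) ∧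
      ∀ a : Fˣ, a ≠ 1 → fixCount (upperTri a 1 (0 : F)) - 1 = 1 := by
  obtain ⟨μ, h1, h2⟩ := exists_monoidHom_trace_upperTri hq V hV
  let W := V ⊗ linearRep (μ⁻¹.comp GeneralLinearGroup.det)
  have hW : ∀ g, W.character g =
      V.character g * (μ⁻¹.comp GeneralLinearGroup.det : _ →* ℂˣ) g := fun g => by
    rw [FDRep.char_tensor, Pi.mul_apply, character_linearRep]
  have := simple_of_character_eq_mul _ V W hW
  have hWdim : finrank ℂ W ≠ 1 := by
    have := hW 1
    rw [FDRep.char_one, FDRep.char_one, hV, map_one, Units.val_one, mul_one] at this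
    have : finrank ℂ W = Fintype.card F := by exact_mod_cast this
    lia
  have hsum : ∑ a, ∑ d, ∑ x, W.character (upperTri a d x) =
      Fintype.card F * ((Fintype.card F : ℂ) - 1) ^ 2 := by
    have hin : ∀ a d : Fˣ, ∑ x, W.character (upperTri a d x) = Fintype.card F := fun a d => by
      simp only [hW, MonoidHom.comp_apply, det_upperTri]
      rw [← Finset.sum_mul, h1, mul_assoc, MonoidHom.inv_apply, Units.mul_inv, mul_one]
    have h1 : 1 ≤ Fintype.card F := Fintype.card_pos
    simp [hin, Fintype.card_units, Nat.cast_sub h1]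
    ring
  have hst := character_eq_fixCount_sub_one W hWdim hsum
  have hV' : ∀ g, V.character g = (fixCount g - 1) * μ (GeneralLinearGroup.det g) := fun g => by
    rw [← hst, hW, MonoidHom.comp_apply, MonoidHom.inv_apply, mul_assoc, Units.inv_mul, mul_one]
  refine ⟨μ, hV', fun a ha => ?_⟩
  have := (h2 a ha).symm.trans (hV' _)
  rw [det_upperTri, mul_one] at this
  exact (mul_right_cancel₀ (Units.ne_zero (μ a)) (by rw [one_mul]; exact this)).symm

/-- The multiplicity of a twisted Steinberg character in the square of the Steinberg
character. -/
theorem sum_fixCount_sub_one_pow_three (hq : 3 ≤ Fintype.card F)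
    (V : FDRep ℂ (GL (Fin 2) F)) [Simple V] (hV : finrank ℂ V = Fintype.card F)
    (ν : Fˣ →* ℂˣ) :
    ∑ g : GL (Fin 2) F, (fixCount g - 1) ^ 3 * (ν (GeneralLinearGroup.det g) : ℂ) =
      if ν ^ 2 = 1 then (Nat.card (GL (Fin 2) F) : ℂ) else 0 := by
  obtain ⟨μ, hμ, -⟩ := exists_character_eq_fixCount_sub_one_mul hq V hV
  have h1 : ∑ g : GL (Fin 2) F, (fixCount g - 1) * (ν (GeneralLinearGroup.det g) : ℂ) = 0 := by
    rw [← sum_character_mul_linear_eq_zero V (by lia)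
      ((μ⁻¹ * ν).comp GeneralLinearGroup.det)]
    refine Finset.sum_congr rfl fun g _ => ?_
    simp [hμ, mul_assoc]
  have hinj : Function.Injective fun a : Fˣ => upperTri a a (0 : F) := fun a b h => by
    have h' := congrArg (fun g : GL (Fin 2) F => g 0 0) h
    exact Units.ext (by simpa using h')
  have hsum : ∑ a : Fˣ, ((ν ^ 2) a : ℂ) = if ν ^ 2 = 1 then (Fintype.card Fˣ : ℂ) else 0 := by
    have := sum_hom_units ((Units.coeHom ℂ).comp (ν ^ 2))
    refine this.trans ?_
    have h2 : (Units.coeHom ℂ).comp (ν ^ 2) = 1 ↔ ν ^ 2 = 1 := by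
      constructor
      · intro h
        ext a
        exact DFunLike.congr_fun h a
      · rintro h
        rw [h]
        rfl
    simp only [h2]
    push_cast
    rfl
  simp only [fixCount_sub_one_pow_three, add_mul, Finset.sum_add_distrib, h1, zero_add, ite_mul,
    zero_mul]
  rw [← Finset.sum_filter]
  have : (Finset.univ.filter fun g => g ∈ Set.range fun a : Fˣ => upperTri a a (0 : F)) =
      Finset.univ.map ⟨_, hinj⟩ := by
    ext g
    simp
  rw [this, Finset.sum_map, ← Finset.mul_sum]
  have h3 : ∀ a : Fˣ, (ν (GeneralLinearGroup.det (upperTri a a (0 : F))) : ℂ) = ((ν ^ 2) a : ℂ) :=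
    fun a => by simp [sq]
  simp only [Function.Embedding.coeFn_mk, h3, hsum]
  have hc : 1 ≤ Fintype.card F := Fintype.card_pos
  rw [mul_ite, mul_zero, card_generalLinearGroup_fin_two, Fintype.card_units, Nat.cast_sub hc]
  congr 1
  push_cast
  ring

end Steinberg

section Count

variable {F : Type} [Field F] [Fintype F]

theorem card_monoidHom_sq_eq_one :
    Nat.card {ν : Fˣ →* ℂˣ // ν ^ 2 = 1} = if Odd (Fintype.card F) then 2 else 1 := by
  obtain ⟨e⟩ := CommGroup.monoidHom_mulEquiv_of_hasEnoughRootsOfUnity Fˣ ℂ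
  have h : Nat.card {ν : Fˣ →* ℂˣ // ν ^ 2 = 1} = Nat.card ({1, -1} : Set Fˣ) := by
    refine Nat.card_congr (e.toEquiv.subtypeEquiv fun ν => ?_)
    rw [Set.mem_insert_iff, Set.mem_singleton_iff]
    have hx : ∀ x : Fˣ, x ^ 2 = 1 ↔ x = 1 ∨ x = -1 := fun x => by
      simp only [Units.ext_iff, Units.val_pow_eq_pow_val, Units.val_one, Units.val_neg]
      exact sq_eq_one_iff
    rw [← hx, ← e.injective.eq_iff, map_pow, map_one]
    rfl
  rw [h]
  by_cases hF : ringChar F = 2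
  · have := FiniteField.even_card_of_char_two hF
    have hodd : ¬ Odd (Fintype.card F) := by
      rw [Nat.odd_iff]; lia
    have : CharP F 2 := ringChar.of_eq hF
    have h1 : (-1 : Fˣ) = 1 := Units.ext (CharTwo.neg_eq (1 : F))
    simp [hodd, h1]
  · have hodd : Odd (Fintype.card F) := Nat.odd_iff.2 (FiniteField.odd_card_of_char_ne_two hF)
    have h1 : (1 : Fˣ) ≠ -1 := fun h => Ring.neg_one_ne_one_of_char_ne_two hF
      (congrArg Units.val h).symm
    rw [if_pos hodd, Nat.card_coe_set_eq, Set.ncard_pair h1]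

/-- The multiplicity of a twisted Steinberg representation in a product of two others. -/
theorem one_le_finrank_hom_tensor_iff (hq : 3 ≤ Fintype.card F)
    {V₁ V₂ V : FDRep ℂ (GL (Fin 2) F)} [Simple V₁] (hV₁ : finrank ℂ V₁ = Fintype.card F)
    {μ₁ μ₂ μ : Fˣ →* ℂˣ}
    (h₁ : ∀ g, V₁.character g = (fixCount g - 1) * μ₁ (GeneralLinearGroup.det g))
    (h₂ : ∀ g, V₂.character g = (fixCount g - 1) * μ₂ (GeneralLinearGroup.det g))
    (h : ∀ g, V.character g = (fixCount g - 1) * μ (GeneralLinearGroup.det g)) :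
    1 ≤ finrank ℂ (V ⟶ V₁ ⊗ V₂) ↔ (μ₁ * μ₂ * μ⁻¹) ^ 2 = 1 := by
  have := invertibleOfNonzero (NeZero.ne (Nat.card (GL (Fin 2) F) : ℂ))
  have hinv : ∀ g : GL (Fin 2) F, fixCount g⁻¹ = fixCount g := fun g => by
    unfold fixCount
    congr 2
    ext x
    rw [Finset.mem_filter, Finset.mem_filter, inv_smul_eq_iff, eq_comm]
  have hs := FDRep.scalar_product_char_eq_finrank_equivariant V (V₁ ⊗ V₂)
  have hg : ∀ g, (V₁ ⊗ V₂).character g * V.character g⁻¹ =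
      (fixCount g - 1) ^ 3 * ((μ₁ * μ₂ * μ⁻¹) (GeneralLinearGroup.det g) : ℂ) := fun g => by
    rw [FDRep.char_tensor, Pi.mul_apply, h₁, h₂, h, hinv, map_inv, map_inv]
    simp only [MonoidHom.mul_apply, MonoidHom.inv_apply, Units.val_mul]
    ring
  simp only [hg, sum_fixCount_sub_one_pow_three hq V₁ hV₁] at hs
  split_ifs at hs with h'
  · simp only [h', iff_true]
    have : (1 : ℂ) = finrank ℂ (V ⟶ V₁ ⊗ V₂) := by
      rw [← hs]
      simp
    have : 1 = finrank ℂ (V ⟶ V₁ ⊗ V₂) := by exact_mod_cast this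
    exact this.le
  · have : (0 : ℂ) = finrank ℂ (V ⟶ V₁ ⊗ V₂) := by
      rw [← hs]
      simp
    have : 0 = finrank ℂ (V ⟶ V₁ ⊗ V₂) := by exact_mod_cast this
    simp only [h', iff_false]
    lia


end Count

end

theorem sq_mul_inv_eq_one_iff {A : Type*} [CommGroup A] (a b : A) :
    (a * b⁻¹) ^ 2 = 1 ↔ (a⁻¹ * b) ^ 2 = 1 := by
  rw [← inv_eq_one, ← inv_pow, mul_inv, inv_inv]

/-- For `q ≥ 3` a prime power and `π₁, π₂` irreducible complex representations of `GL₂(q)`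
of dimension `q`, the number of isomorphism classes of irreducible representations of
dimension `q` occurring in `π₁ ⊗ π₂` is `2` if `q` is odd and `1` if `q` is even. -/
theorem card_dim_q_constituents_tensor_q_q (q : ℕ) (hq : 3 ≤ q)
    (F : Type) [Field F] [Fintype F] (hF : Fintype.card F = q)
    (π₁ π₂ : FDRep ℂ (Matrix.GeneralLinearGroup (Fin 2) F)) [Simple π₁] [Simple π₂]
    (h₁ : finrank ℂ π₁ = q) (h₂ : finrank ℂ π₂ = q) :
    Nat.card (Quotient (isoSetoid
        (fun χ : FDRep ℂ (Matrix.GeneralLinearGroup (Fin 2) F) =>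
          Simple χ ∧ finrank ℂ χ = q ∧ 1 ≤ finrank ℂ (χ ⟶ π₁ ⊗ π₂)))) =
      if Odd q then 2 else 1 := by
  subst hF
  rw [← card_monoidHom_sq_eq_one]
  obtain ⟨μ₁, hμ₁, hone⟩ := exists_character_eq_fixCount_sub_one_mul hq π₁ h₁
  obtain ⟨μ₂, hμ₂, -⟩ := exists_character_eq_fixCount_sub_one_mul hq π₂ h₂
  let W (ν : Fˣ →* ℂˣ) : FDRep ℂ (Matrix.GeneralLinearGroup (Fin 2) F) :=
    π₁ ⊗ linearRep ((ν * μ₂).comp Matrix.GeneralLinearGroup.det)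
  have hW' : ∀ ν g, (W ν).character g = π₁.character g *
      ((ν * μ₂).comp Matrix.GeneralLinearGroup.det : _ →* ℂˣ) g := fun ν g => by
    rw [FDRep.char_tensor, Pi.mul_apply, character_linearRep]
  have hW : ∀ ν g, (W ν).character g =
      (fixCount g - 1) * ((μ₁ * μ₂ * ν) (Matrix.GeneralLinearGroup.det g) : ℂ) := fun ν g => by
    rw [hW', hμ₁]
    simp only [MonoidHom.comp_apply, MonoidHom.mul_apply, Units.val_mul]
    ring
  have hsimple : ∀ ν, Simple (W ν) := fun ν => simple_of_character_eq_mul _ π₁ _ (hW' ν)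
  have hdim : ∀ ν, finrank ℂ (W ν) = Fintype.card F := fun ν => by
    have := hW' ν 1
    rw [FDRep.char_one, FDRep.char_one, h₁, map_one, Units.val_one, mul_one] at this
    exact_mod_cast this
  have hmul : ∀ ν : Fˣ →* ℂˣ, 1 ≤ finrank ℂ (W ν ⟶ π₁ ⊗ π₂) ↔ ν ^ 2 = 1 := fun ν => by
    refine (one_le_finrank_hom_tensor_iff hq h₁ hμ₁ hμ₂ (hW ν)).trans ?_
    refine (sq_mul_inv_eq_one_iff (μ₁ * μ₂) (μ₁ * μ₂ * ν)).trans ?_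
    rw [inv_mul_cancel_left]
  symm
  refine Nat.card_eq_of_bijective
    (fun ν => Quotient.mk _ ⟨W ν.1, hsimple _, hdim _, (hmul _).2 ν.2⟩) ⟨?_, ?_⟩
  · rintro ⟨ν, hν⟩ ⟨ν', hν'⟩ h
    obtain ⟨e⟩ : Nonempty (W ν ≅ W ν') := Quotient.exact h
    refine Subtype.ext (MonoidHom.ext fun a => ?_)
    by_cases ha : a = 1
    · rw [ha, map_one, map_one]
    have h := congrFun (FDRep.char_iso e) (upperTri a 1 0)
    rw [hW, hW, hone a ha, one_mul, one_mul, det_upperTri, mul_one] at h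
    exact mul_left_cancel (Units.ext h)
  · intro c
    induction c using Quotient.inductionOn with
    | h χ =>
      obtain ⟨χ, hχ, hχdim, hχmul⟩ := χ
      obtain ⟨μ, hμ, -⟩ := exists_character_eq_fixCount_sub_one_mul hq χ hχdim
      have hν := (sq_mul_inv_eq_one_iff (μ₁ * μ₂) μ).1
        ((one_le_finrank_hom_tensor_iff hq h₁ hμ₁ hμ₂ hμ).1 hχmul)
      refine ⟨⟨_, hν⟩, Quotient.sound ?_⟩
      have := hsimple ((μ₁ * μ₂)⁻¹ * μ)
      refine FDRep.nonempty_iso_of_character_eq (V := W _) (W := χ) (funext fun g => ?_)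
      rw [hW, hμ, mul_inv_cancel_left]
end
end
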